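/- arXiv:1904.10028 — 7 statements merged into one kernel-verified Lean document; each statement's English description precedes it below -/
import Mathlib

section
/- For all integers n ≥ 2, g(f^n(0)) = g(f^{n-1}(0)) · g(f^{n-2}(3)) · g(f^{n-1}(0)), where · denotes concatenation of words. -/
/-- Extension of a morphism (given on letters) to finite words by concatenation. -/
def applyM {α β : Type*} (h : α → List β) (w : List α) : List β := w.flatMap h

/-- The morphism f on the alphabet {0,1,2,3,4,5}:
    f(0)=012, f(1)=304, f(2)=0, f(3)=354, f(4)=3, f(5)=032. -/
def fm : Fin 6 → List (Fin 6) := ![[0,1,2],[3,0,4],[0],[3,5,4],[3],[0,3,2]]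

/-- The morphism g to the binary alphabet:
    g(0)=0, g(1)=0, g(2)=ε, g(3)=1, g(4)=ε, g(5)=1. -/
def gm : Fin 6 → List (Fin 2) := ![[0],[0],[],[1],[],[1]]

/-- `fpow n w` is the word f^n(w). -/
def fpow (n : ℕ) (w : List (Fin 6)) : List (Fin 6) := (applyM fm)^[n] w

theorem fpow_append (n : ℕ) (u v : List (Fin 6)) :
    fpow n (u ++ v) = fpow n u ++ fpow n v := by
  induction n generalizing u v with
  | zero => rfl
  | succ n ih =>
    simp only [fpow, Function.iterate_succ_apply] at ih ⊢
    rw [← ih]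
    simp [applyM]

theorem applyM_gm_fpow_append (n : ℕ) (u v : List (Fin 6)) :
    applyM gm (fpow n (u ++ v)) = applyM gm (fpow n u) ++ applyM gm (fpow n v) := by
  rw [fpow_append]
  simp [applyM]

theorem fpow_succ (n : ℕ) (w : List (Fin 6)) : fpow (n + 1) w = fpow n (applyM fm w) :=
  Function.iterate_succ_apply _ _ _

/-- The recurrence of `stmt0` without truncated subtraction. -/
theorem applyM_gm_fpow_add_two (n : ℕ) :
    applyM gm (fpow (n + 2) [0]) =
      applyM gm (fpow (n + 1) [0]) ++ applyM gm (fpow n [3]) ++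
        applyM gm (fpow (n + 1) [0]) := by
  induction n with
  | zero => decide
  | succ n ih =>
    have h0 : applyM gm (fpow (n + 3) [0]) = applyM gm (fpow (n + 2) [0]) ++
        (applyM gm (fpow (n + 2) [1]) ++ applyM gm (fpow (n + 1) [0])) := by
      rw [fpow_succ (n + 2), show applyM fm [0] = [0] ++ ([1] ++ [2]) from rfl,
        applyM_gm_fpow_append, applyM_gm_fpow_append, fpow_succ (n + 1) [2]]
      rfl
    have h1 : applyM gm (fpow (n + 2) [1]) = applyM gm (fpow (n + 1) [3]) ++
        (applyM gm (fpow (n + 1) [0]) ++ applyM gm (fpow n [3])) := by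
      rw [fpow_succ (n + 1), show applyM fm [1] = [3] ++ ([0] ++ [4]) from rfl,
        applyM_gm_fpow_append, applyM_gm_fpow_append, fpow_succ n [4]]
      rfl
    rw [h0, h1]
    simp only [List.append_assoc] at ih ⊢
    rw [← ih]

theorem stmt0 (n : ℕ) (hn : 2 ≤ n) :
    applyM gm (fpow n [0]) =
      applyM gm (fpow (n-1) [0]) ++ applyM gm (fpow (n-2) [3]) ++
        applyM gm (fpow (n-1) [0]) := by
  obtain ⟨k, rfl⟩ := Nat.exists_eq_add_of_le' hn
  exact applyM_gm_fpow_add_two k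
end

section
/- For all integers n ≥ 2, g(f^n(3)) = g(f^{n-1}(3)) · g(f^{n-2}(0)) · g(f^{n-1}(3)), where · denotes concatenation of words. -/
theorem applyM_gm_fpow_succ_three (m : ℕ) :
    applyM gm (fpow (m + 1) [3]) =
      applyM gm (fpow m [3]) ++ applyM gm (fpow m [2]) ++ applyM gm (fpow m [3]) := by
  induction m with
  | zero => decide
  | succ m ih =>
    have h3 : fpow (m + 1 + 1) [3] = fpow (m + 1) ([3] ++ [5] ++ [4]) := rfl
    have h5 : fpow (m + 1) [5] = fpow m ([0] ++ [3] ++ [2]) := rfl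
    have h4 : fpow (m + 1) [4] = fpow m [3] := rfl
    have h2 : fpow (m + 1) [2] = fpow m [0] := rfl
    rw [h3, h2, applyM_gm_fpow_append, applyM_gm_fpow_append, h5, h4,
      applyM_gm_fpow_append, applyM_gm_fpow_append, ih]
    simp only [List.append_assoc]

theorem stmt1 (n : ℕ) (hn : 2 ≤ n) :
    applyM gm (fpow n [3]) =
      applyM gm (fpow (n-1) [3]) ++ applyM gm (fpow (n-2) [0]) ++
        applyM gm (fpow (n-1) [3]) := by
  obtain ⟨m, rfl⟩ := Nat.exists_eq_add_of_le' hn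
  exact applyM_gm_fpow_succ_three (m + 1)
end

section
/- For all integers k ≥ 1, the following three identities hold: τ(φ^k(0)) = g(f^k(0)) · g(f^{k-1}(3)), τ(φ^k(1)) = g(f^k(0)) · g(f^k(3)), and τ(φ^k(2)) = g(f^k(0)) · g(f^{k+1}(3)), where · denotes concatenation of words. -/
/-- The morphism φ on the alphabet {0,1,2}: φ(0)=01, φ(1)=02, φ(2)=022. -/
def phim : Fin 3 → List (Fin 3) := ![[0,1],[0,2],[0,2,2]]

/-- The morphism τ to the binary alphabet: τ(0)=0, τ(1)=01, τ(2)=011. -/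
def taum : Fin 3 → List (Fin 2) := ![[0],[0,1],[0,1,1]]

/-- `phipow n w` is the word φ^n(w). -/
def phipow (n : ℕ) (w : List (Fin 3)) : List (Fin 3) := (applyM phim)^[n] w

theorem applyM_append {α β : Type*} (h : α → List β) (u v : List α) :
    applyM h (u ++ v) = applyM h u ++ applyM h v := by
  simp [applyM]

theorem phipow_append (n : ℕ) (u v : List (Fin 3)) :
    phipow n (u ++ v) = phipow n u ++ phipow n v := by
  induction n generalizing u v with
  | zero => rfl
  | succ n ih => simpa only [phipow, Function.iterate_succ_apply, applyM_append] using ih _ _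

/-- The binary word `g(f^n(x))`. -/
def gfWord (n : ℕ) (x : Fin 6) : List (Fin 2) := applyM gm (fpow n [x])

/-- The binary word `τ(φ^n(x))`. -/
def tauPhiWord (n : ℕ) (x : Fin 3) : List (Fin 2) := applyM taum (phipow n [x])

theorem applyM_gm_fpow_cons (n : ℕ) (x : Fin 6) (w : List (Fin 6)) :
    applyM gm (fpow n (x :: w)) = gfWord n x ++ applyM gm (fpow n w) := by
  rw [gfWord, ← applyM_append, ← fpow_append, List.singleton_append]

theorem applyM_taum_phipow_cons (n : ℕ) (x : Fin 3) (w : List (Fin 3)) :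
    applyM taum (phipow n (x :: w)) = tauPhiWord n x ++ applyM taum (phipow n w) := by
  rw [tauPhiWord, ← applyM_append, ← phipow_append, List.singleton_append]

theorem gfWord_succ_zero (n : ℕ) :
    gfWord (n + 1) 0 = gfWord n 0 ++ (gfWord n 1 ++ gfWord n 2) := by
  change applyM gm (fpow n [0, 1, 2]) = _
  simp only [applyM_gm_fpow_cons n _ (_ :: _)]
  rfl

theorem gfWord_succ_one (n : ℕ) :
    gfWord (n + 1) 1 = gfWord n 3 ++ (gfWord n 0 ++ gfWord n 4) := by
  change applyM gm (fpow n [3, 0, 4]) = _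
  simp only [applyM_gm_fpow_cons n _ (_ :: _)]
  rfl

theorem gfWord_succ_two (n : ℕ) : gfWord (n + 1) 2 = gfWord n 0 := rfl

theorem gfWord_succ_three (n : ℕ) :
    gfWord (n + 1) 3 = gfWord n 3 ++ (gfWord n 5 ++ gfWord n 4) := by
  change applyM gm (fpow n [3, 5, 4]) = _
  simp only [applyM_gm_fpow_cons n _ (_ :: _)]
  rfl

theorem gfWord_succ_four (n : ℕ) : gfWord (n + 1) 4 = gfWord n 3 := rfl

theorem gfWord_succ_five (n : ℕ) :
    gfWord (n + 1) 5 = gfWord n 0 ++ (gfWord n 3 ++ gfWord n 2) := by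
  change applyM gm (fpow n [0, 3, 2]) = _
  simp only [applyM_gm_fpow_cons n _ (_ :: _)]
  rfl

theorem tauPhiWord_succ_zero (n : ℕ) :
    tauPhiWord (n + 1) 0 = tauPhiWord n 0 ++ tauPhiWord n 1 := by
  change applyM taum (phipow n [0, 1]) = _
  simp only [applyM_taum_phipow_cons n _ (_ :: _)]
  rfl

theorem tauPhiWord_succ_one (n : ℕ) :
    tauPhiWord (n + 1) 1 = tauPhiWord n 0 ++ tauPhiWord n 2 := by
  change applyM taum (phipow n [0, 2]) = _
  simp only [applyM_taum_phipow_cons n _ (_ :: _)]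
  rfl

theorem tauPhiWord_succ_two (n : ℕ) :
    tauPhiWord (n + 1) 2 = tauPhiWord n 0 ++ (tauPhiWord n 2 ++ tauPhiWord n 2) := by
  change applyM taum (phipow n [0, 2, 2]) = _
  simp only [applyM_taum_phipow_cons n _ (_ :: _)]
  rfl

theorem gfWord_one_append_zero (n : ℕ) :
    gfWord (n + 1) 1 ++ gfWord n 0 = gfWord n 3 ++ gfWord (n + 1) 0 := by
  induction n with
  | zero => decide
  | succ n ih =>
    rw [gfWord_succ_one (n + 1), gfWord_succ_zero (n + 1), gfWord_succ_four, gfWord_succ_two, ih]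
    simp only [List.append_assoc]

theorem gfWord_five_append_three (n : ℕ) :
    gfWord (n + 1) 5 ++ gfWord n 3 = gfWord n 0 ++ gfWord (n + 1) 3 := by
  induction n with
  | zero => decide
  | succ n ih =>
    rw [gfWord_succ_five (n + 1), gfWord_succ_three (n + 1), gfWord_succ_four, gfWord_succ_two, ih]
    simp only [List.append_assoc]

theorem gfWord_add_two_zero (n : ℕ) :
    gfWord (n + 2) 0 = gfWord (n + 1) 0 ++ (gfWord n 3 ++ gfWord (n + 1) 0) := by
  rw [gfWord_succ_zero (n + 1), gfWord_succ_two, gfWord_one_append_zero]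

theorem gfWord_add_two_three (n : ℕ) :
    gfWord (n + 2) 3 = gfWord (n + 1) 3 ++ (gfWord n 0 ++ gfWord (n + 1) 3) := by
  rw [gfWord_succ_three (n + 1), gfWord_succ_four, gfWord_five_append_three]

theorem tauPhiWord_succ_eq_gfWord (n : ℕ) :
    tauPhiWord (n + 1) 0 = gfWord (n + 1) 0 ++ gfWord n 3 ∧
    tauPhiWord (n + 1) 1 = gfWord (n + 1) 0 ++ gfWord (n + 1) 3 ∧
    tauPhiWord (n + 1) 2 = gfWord (n + 1) 0 ++ gfWord (n + 2) 3 := by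
  induction n with
  | zero => decide
  | succ n ih =>
    obtain ⟨h0, h1, h2⟩ := ih
    refine ⟨?_, ?_, ?_⟩
    · rw [tauPhiWord_succ_zero, h0, h1, gfWord_add_two_zero]
      simp only [List.append_assoc]
    · rw [tauPhiWord_succ_one, h0, h2, gfWord_add_two_zero]
      simp only [List.append_assoc]
    · rw [tauPhiWord_succ_two, h0, h2, gfWord_add_two_three (n + 1), gfWord_add_two_zero]
      simp only [List.append_assoc]

theorem stmt2 (k : ℕ) (hk : 1 ≤ k) :
    applyM taum (phipow k [0]) = applyM gm (fpow k [0]) ++ applyM gm (fpow (k-1) [3]) ∧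
    applyM taum (phipow k [1]) = applyM gm (fpow k [0]) ++ applyM gm (fpow k [3]) ∧
    applyM taum (phipow k [2]) = applyM gm (fpow k [0]) ++ applyM gm (fpow (k+1) [3]) := by
  obtain ⟨n, rfl⟩ := Nat.exists_eq_add_of_le' hk
  exact tauPhiWord_succ_eq_gfWord n
end

section
/- For all integers k ≥ 1, the word g(f^k(0)) is a prefix of the word τ(φ^k(0)); consequently the infinite words τ(φ^ω(0)) and g(f^ω(0)) are equal. -/
theorem iterate_applyM_append {α : Type*} (h : α → List α) (n : ℕ) (u v : List α) :
    (applyM h)^[n] (u ++ v) = (applyM h)^[n] u ++ (applyM h)^[n] v := by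
  induction n generalizing u v with
  | zero => rfl
  | succ n ih => simp only [Function.iterate_succ_apply, applyM_append, ih]

/-- The word `g(f^k(w))`. -/
def gfpow (k : ℕ) (w : List (Fin 6)) : List (Fin 2) := applyM gm (fpow k w)

/-- The word `τ(φ^k(w))`. -/
def tauphipow (k : ℕ) (w : List (Fin 3)) : List (Fin 2) := applyM taum (phipow k w)

theorem gfpow_append (k : ℕ) (u v : List (Fin 6)) :
    gfpow k (u ++ v) = gfpow k u ++ gfpow k v := by
  simp only [gfpow, fpow, iterate_applyM_append, applyM_append]

theorem tauphipow_append (k : ℕ) (u v : List (Fin 3)) :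
    tauphipow k (u ++ v) = tauphipow k u ++ tauphipow k v := by
  simp only [tauphipow, phipow, iterate_applyM_append, applyM_append]

theorem gfpow_succ (k : ℕ) (w : List (Fin 6)) :
    gfpow (k + 1) w = gfpow k (applyM fm w) := rfl

theorem tauphipow_succ (k : ℕ) (w : List (Fin 3)) :
    tauphipow (k + 1) w = tauphipow k (applyM phim w) := rfl

/-- The words `12`, `40` and the words `23`, `54` have the same image under `g ∘ f^k`. -/
theorem gfpow_swap (k : ℕ) :
    gfpow k [1, 2] = gfpow k [4, 0] ∧ gfpow k [2, 3] = gfpow k [5, 4] := by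
  induction k with
  | zero => decide
  | succ k ih =>
    obtain ⟨h₁, h₂⟩ := ih
    constructor
    · change gfpow k ([3, 0, 4] ++ [0]) = gfpow k ([3] ++ [0, 1, 2])
      rw [show ([3, 0, 4] ++ [0] : List (Fin 6)) = [3, 0] ++ [4, 0] from rfl,
        show ([3] ++ [0, 1, 2] : List (Fin 6)) = [3, 0] ++ [1, 2] from rfl,
        gfpow_append, gfpow_append, h₁]
    · change gfpow k ([0, 3] ++ [5, 4]) = gfpow k ([0, 3] ++ [2, 3])
      rw [gfpow_append, gfpow_append, h₂]

/-- The images of the letters under `τ ∘ φ^k`, written as images under `g ∘ f^k`. -/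
theorem tauphipow_letters (k : ℕ) :
    tauphipow k [0] = gfpow k [0, 4] ∧ tauphipow k [1] = gfpow k [0, 3] ∧
      tauphipow k [2] = gfpow k [0, 3, 5, 4] := by
  induction k with
  | zero => decide
  | succ k ih =>
    obtain ⟨h₀, h₁, h₂⟩ := ih
    obtain ⟨e₁, e₂⟩ := gfpow_swap k
    refine ⟨?_, ?_, ?_⟩
    · change tauphipow k ([0] ++ [1]) = gfpow k ([0] ++ ([1, 2] ++ [3]))
      rw [tauphipow_append, h₀, h₁]
      simp only [gfpow_append, e₁]
      simp only [← gfpow_append]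
      rfl
    · change tauphipow k ([0] ++ [2]) = gfpow k ([0] ++ ([1, 2] ++ [3, 5, 4]))
      rw [tauphipow_append, h₀, h₂]
      simp only [gfpow_append, e₁]
      simp only [← gfpow_append]
      rfl
    · change tauphipow k ([0] ++ ([2] ++ [2])) =
        gfpow k ([0] ++ ([1, 2] ++ ([3, 5, 4, 0, 3] ++ [2, 3])))
      rw [tauphipow_append, tauphipow_append, h₀, h₂]
      simp only [gfpow_append, e₁, e₂]
      simp only [← gfpow_append]
      rfl

theorem gfpow_zero_prefix (k : ℕ) : gfpow k [0] <+: tauphipow k [0] :=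
  ⟨gfpow k [4], by rw [(tauphipow_letters k).1, ← gfpow_append]; rfl⟩

theorem lt_length_gfpow (k : ℕ) :
    k < (gfpow k [0]).length ∧ 0 < (gfpow k [1]).length := by
  induction k with
  | zero => decide
  | succ k ih =>
    have h₀ : gfpow (k + 1) [0] = gfpow k [0] ++ (gfpow k [1] ++ gfpow k [2]) := by
      simp only [← gfpow_append]
      rfl
    have h₁ : gfpow (k + 1) [1] = gfpow k [3] ++ (gfpow k [0] ++ gfpow k [4]) := by
      simp only [← gfpow_append]
      rfl
    simp only [h₀, h₁, List.length_append]
    omega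

theorem stmt3 :
    (∀ k : ℕ, 1 ≤ k → applyM gm (fpow k [0]) <+: applyM taum (phipow k [0])) ∧
    (∀ m : ℕ,
      (applyM taum (phipow (m+1) [0]))[m]? = (applyM gm (fpow (m+1) [0]))[m]? ∧
      (applyM taum (phipow (m+1) [0]))[m]?.isSome) := by
  refine ⟨fun k _ => gfpow_zero_prefix k, fun m => ?_⟩
  have hlen : m < (gfpow (m + 1) [0]).length := by
    have := (lt_length_gfpow (m + 1)).1
    omega
  have hpre := gfpow_zero_prefix (m + 1)
  have hget : (tauphipow (m + 1) [0])[m]? = (gfpow (m + 1) [0])[m]? := by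
    obtain ⟨t, ht⟩ := hpre
    rw [← ht, List.getElem?_append_left hlen]
  refine ⟨hget, ?_⟩
  change (tauphipow (m + 1) [0])[m]?.isSome
  rw [hget, List.getElem?_eq_getElem hlen]
  rfl
end

section
/- For every integer n ≥ 0, the binary word τ(φ^n(0)) is rich, i.e., the number of distinct nonempty palindromic factors of τ(φ^n(0)) equals its length. -/
/-- A finite word is rich if its number of distinct nonempty palindromic factors
equals its length. -/
def Rich {α : Type*} (w : List α) : Prop :=
  {u : List α | u ≠ [] ∧ u <:+: w ∧ u.reverse = u}.ncard = w.length

theorem applyM_cons {α β : Type*} (h : α → List β) (a : α) (v : List α) :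
    applyM h (a :: v) = h a ++ applyM h v := List.flatMap_cons

theorem applyM_nil {α β : Type*} (h : α → List β) : applyM h [] = [] := rfl

/-! ### Richness and palindromic suffixes -/

/-- The nonempty palindromic factors of `w`. -/
def palFactors {α : Type*} (w : List α) : Set (List α) :=
  {u : List α | u ≠ [] ∧ u <:+: w ∧ u.reverse = u}

theorem palFactors_finite {α : Type*} (w : List α) : (palFactors w).Finite :=
  w.sublists.finite_toSet.subset fun _ hu => List.mem_sublists.2 hu.2.1.sublist

theorem infix_concat_iff {α : Type*} {u w : List α} {c : α} :
    u <:+: w ++ [c] ↔ u <:+: w ∨ u <:+ w ++ [c] := by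
  constructor
  · rintro ⟨s, t, h⟩
    rcases List.eq_nil_or_concat t with rfl | ⟨t, d, rfl⟩
    · exact Or.inr ⟨s, by simpa using h⟩
    · left
      rw [List.concat_eq_append, ← List.append_assoc] at h
      exact ⟨s, t, (List.append_inj' h rfl).1⟩
  · rintro (h | h)
    · exact h.trans (List.prefix_append _ _).isInfix
    · exact h.isInfix

/-- A palindrome that is a proper suffix of a palindromic suffix of `w ++ [c]` is a factor
of `w`. -/
theorem infix_of_suffix_palindrome {α : Type*} {u q w : List α} {c : α}
    (hu : u.reverse = u) (hq : q.reverse = q) (huw : u <:+ w ++ [c]) (hqu : q <:+ u)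
    (hne : q ≠ u) : q <:+: w := by
  have hpre : q <+: u := by
    have := List.reverse_prefix.2 hqu
    rwa [hu, hq] at this
  obtain ⟨t, rfl⟩ := hpre
  obtain ⟨s, hs⟩ := huw
  rcases List.eq_nil_or_concat t with rfl | ⟨t, d, rfl⟩
  · simp at hne
  · rw [List.concat_eq_append, ← List.append_assoc, ← List.append_assoc] at hs
    exact ⟨s, t, by simpa using (List.append_inj' hs rfl).1⟩

theorem Rich.concat {α : Type*} {w u : List α} {c : α} (hw : Rich w) (hne : u ≠ [])
    (hpal : u.reverse = u) (hsuf : u <:+ w ++ [c]) (hnew : ¬ u <:+: w) : Rich (w ++ [c]) := by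
  have key : palFactors (w ++ [c]) = insert u (palFactors w) := by
    ext q
    simp only [palFactors, Set.mem_ofPred_eq, Set.mem_insert_iff, infix_concat_iff]
    constructor
    · rintro ⟨h1, h2 | h2, h3⟩
      · exact Or.inr ⟨h1, h2, h3⟩
      · by_cases hqu : q = u
        · exact Or.inl hqu
        · rcases List.suffix_or_suffix_of_suffix h2 hsuf with h | h
          · exact Or.inr ⟨h1, infix_of_suffix_palindrome hpal h3 hsuf h hqu, h3⟩
          · exact absurd (infix_of_suffix_palindrome h3 hpal h2 h (Ne.symm hqu)) hnew
    · rintro (rfl | ⟨h1, h2, h3⟩)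
      · exact ⟨hne, Or.inr hsuf, hpal⟩
      · exact ⟨h1, Or.inl h2, h3⟩
  have hcard : (palFactors w).ncard = w.length := hw
  change (palFactors (w ++ [c])).ncard = _
  rw [key, Set.ncard_insert_of_notMem (fun h => hnew h.2.1) (palFactors_finite w), hcard]
  simp

theorem rich_nil {α : Type*} : Rich ([] : List α) := by
  have : palFactors ([] : List α) = ∅ := by
    ext u
    simp +contextual [palFactors]
  change (palFactors ([] : List α)).ncard = 0
  simp [this]

/-! ### Unioccurrent palindromes up to the extending letters -/

/-- `w` has a palindromic suffix `v`, preceded by a letter of `K`, such that no factor `d v c`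
with `d, c ∈ K` occurs in `w`. -/
def HasNewCore {α : Type*} (K : Finset α) (w : List α) : Prop :=
  ∃ v ∈ w.tails, v.reverse = v ∧ (∃ d ∈ K, d :: v <:+ w) ∧
    ∀ d ∈ K, ∀ c ∈ K, ¬ d :: (v ++ [c]) <:+: w

instance {α : Type*} [DecidableEq α] (K : Finset α) (w : List α) :
    Decidable (HasNewCore K w) := by
  unfold HasNewCore; infer_instance

theorem Rich.concat_of_hasNewCore {α : Type*} {w : List α} {c : α} (hw : Rich w)
    (h : HasNewCore {c} w) : Rich (w ++ [c]) := by
  obtain ⟨v, -, hv, ⟨d, hd, hs⟩, hu⟩ := h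
  obtain rfl := Finset.mem_singleton.1 hd
  refine hw.concat (u := d :: (v ++ [d])) (by simp) (by simp [hv]) ?_ (hu d hd d hd)
  obtain ⟨t, ht⟩ := hs
  exact ⟨t, by simp [← ht]⟩

/-! ### Morphisms whose images are a marker followed by a palindrome -/

section Marked

variable {α β : Type*} {o : β} {p : α → List β}

theorem eq_of_append_marker {u v s t : List β} (hu : o ∉ u) (hv : o ∉ v)
    (h : u ++ o :: s = v ++ o :: t) : u = v ∧ s = t := by
  induction u generalizing v with
  | nil =>
    cases v with
    | nil => exact ⟨rfl, (List.cons.inj h).2⟩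
    | cons b v => exact absurd (by simp [(List.cons.inj h).1]) hv
  | cons a u ih =>
    cases v with
    | nil => exact absurd (by simp [(List.cons.inj h).1]) hu
    | cons b v =>
      rw [List.mem_cons, not_or] at hu hv
      obtain ⟨hab, h⟩ := List.cons.inj h
      obtain ⟨rfl, hst⟩ := ih hu.2 hv.2 h
      exact ⟨by rw [hab], hst⟩

theorem applyM_marker_head (w : List α) :
    ∃ r, applyM (fun a => o :: p a) w ++ [o] = o :: r := by
  cases w with
  | nil => exact ⟨[], rfl⟩
  | cons a w => exact ⟨_, by rw [applyM_cons]; rfl⟩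

theorem applyM_marker_reverse (hpal : ∀ a, (p a).reverse = p a) (w : List α) :
    (applyM (fun a => o :: p a) w ++ [o]).reverse
      = applyM (fun a => o :: p a) w.reverse ++ [o] := by
  induction w with
  | nil => rfl
  | cons a w ih =>
    simp only [List.reverse_append, List.reverse_cons, List.reverse_nil, List.nil_append,
      applyM_cons, applyM_append, applyM_nil, List.cons_append,
      List.append_nil, List.append_assoc, hpal] at ih ⊢
    rw [← List.cons_append, ih]
    simp

/-- Every marker in the image of `w` starts the image of a suffix of `w`. -/
theorem exists_split_of_marker (h0 : ∀ a, o ∉ p a) {w : List α} {u r : List β}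
    (h : applyM (fun a => o :: p a) w ++ [o] = u ++ o :: r) :
    ∃ w₁ w₂, w = w₁ ++ w₂ ∧ applyM (fun a => o :: p a) w₁ = u ∧
      applyM (fun a => o :: p a) w₂ ++ [o] = o :: r := by
  induction w generalizing u with
  | nil =>
    cases u with
    | nil => exact ⟨[], [], rfl, rfl, h⟩
    | cons b u => simp [applyM_nil] at h
  | cons a w ih =>
    cases u with
    | nil => exact ⟨[], a :: w, rfl, rfl, h⟩
    | cons b u =>
      rw [applyM_cons] at h
      simp only [List.cons_append, List.cons.injEq, List.append_assoc] at h
      obtain ⟨rfl, h⟩ := h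
      rcases List.append_eq_append_iff.1 h with ⟨t, rfl, ht⟩ | ⟨t, ht, ht'⟩
      · obtain ⟨w₁, w₂, rfl, h1, h2⟩ := ih ht
        exact ⟨a :: w₁, w₂, rfl, by simp [applyM_cons, h1], h2⟩
      · cases t with
        | nil =>
          obtain ⟨w₁, w₂, rfl, h1, h2⟩ := ih (u := []) (by simpa using ht'.symm)
          exact ⟨a :: w₁, w₂, rfl, by simp [applyM_cons, h1, ht], h2⟩
        | cons c t =>
          simp only [List.cons_append, List.cons.injEq] at ht'
          exact absurd (by rw [ht, ht'.1]; simp) (h0 a)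

theorem exists_append_of_image_prefix (h0 : ∀ a, o ∉ p a) (hinj : Function.Injective p)
    {w v : List α} {r : List β}
    (h : applyM (fun a => o :: p a) w ++ [o] = applyM (fun a => o :: p a) v ++ o :: r) :
    ∃ x, w = v ++ x ∧ applyM (fun a => o :: p a) x ++ [o] = o :: r := by
  induction v generalizing w with
  | nil => exact ⟨w, rfl, h⟩
  | cons a v ih =>
    cases w with
    | nil => simp [applyM_nil, applyM_cons] at h
    | cons b w =>
      rw [applyM_cons, applyM_cons] at h
      simp only [List.cons_append, List.cons.injEq, List.append_assoc, true_and] at h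
      obtain ⟨s, hs⟩ := applyM_marker_head (o := o) (p := p) w
      have hv : ∃ t, applyM (fun a => o :: p a) v ++ o :: r = o :: t := by
        cases v with
        | nil => exact ⟨r, rfl⟩
        | cons c v => exact ⟨_, by rw [applyM_cons]; rfl⟩
      obtain ⟨t, ht⟩ := hv
      have h' := h
      rw [hs, ht] at h'
      obtain ⟨hab, hst⟩ := eq_of_append_marker (h0 b) (h0 a) h'
      obtain rfl := hinj hab
      obtain ⟨x, rfl, hx⟩ := ih (List.append_cancel_left h)
      exact ⟨x, rfl, hx⟩

/-- Every letter but the first of the image of `w`, followed by a marker, lies in a unique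
shifted block `p y ++ [o]`. -/
theorem exists_block {w : List α} {u r : List β} {z : β}
    (h : applyM (fun a => o :: p a) w ++ [o] = u ++ z :: r) (hu : u ≠ []) :
    ∃ w' y w'' s t, w = w' ++ y :: w'' ∧ u = applyM (fun a => o :: p a) w' ++ o :: s ∧
      p y ++ [o] = s ++ z :: t := by
  induction w generalizing u with
  | nil =>
    cases u with
    | nil => exact absurd rfl hu
    | cons b u => simp [applyM_nil] at h
  | cons a w ih =>
    cases u with
    | nil => exact absurd rfl hu
    | cons b u =>
      rw [applyM_cons] at h
      simp only [List.cons_append, List.cons.injEq, List.append_assoc] at h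
      obtain ⟨rfl, h⟩ := h
      rcases List.append_eq_append_iff.1 h with ⟨t, rfl, ht⟩ | ⟨t, ht, ht'⟩
      · cases t with
        | nil =>
          obtain ⟨q, hq⟩ := applyM_marker_head (o := o) (p := p) w
          rw [hq] at ht
          simp only [List.nil_append, List.cons.injEq] at ht
          exact ⟨[], a, w, p a, [], rfl, by simp [applyM_nil], by simp [ht.1]⟩
        | cons c t =>
          obtain ⟨w', y, w'', s, t', rfl, h1, h2⟩ := ih ht (by simp)
          exact ⟨a :: w', y, w'', s, t', rfl, by simp [applyM_cons, h1], h2⟩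
      · cases t with
        | nil =>
          obtain ⟨q, hq⟩ := applyM_marker_head (o := o) (p := p) w
          rw [hq] at ht'
          simp only [List.nil_append, List.cons.injEq] at ht'
          exact ⟨[], a, w, u, [], rfl, by simp [applyM_nil], by simp [ht, ht'.1]⟩
        | cons c t =>
          simp only [List.cons_append, List.cons.injEq] at ht'
          exact ⟨[], a, w, u, t ++ [o], rfl, by simp [applyM_nil], by simp [ht, ht'.1]⟩

theorem HasNewCore.image (h0 : ∀ a, o ∉ p a) (hpal : ∀ a, (p a).reverse = p a)
    (hinj : Function.Injective p) {K : Finset β} {K' : Finset α} {w : List α} {y : α}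
    {s t : List β} {z : β} (hy : p y ++ [o] = s ++ z :: t) (hs : s.reverse = s)
    (hK : ∀ x, x ∈ K' ↔ ∃ c ∈ K, s ++ [c] <+: p x ++ [o]) (h : HasNewCore K' w) :
    HasNewCore K (applyM (fun a => o :: p a) w ++ o :: s) := by
  set m : α → List β := fun a => o :: p a with hm
  have hos : o ∉ s := by
    have : s <+: p y :=
      List.prefix_of_prefix_length_le (⟨z :: t, hy.symm⟩ : s <+: p y ++ [o])
        (List.prefix_append _ _) (by have := congrArg List.length hy; simp at this; omega)
    exact fun ho => h0 y (this.subset ho)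
  have hK2 : ∀ x, x ∈ K' ↔ ∃ c ∈ K, c :: s <:+ o :: p x := fun x => by
    rw [hK]
    refine exists_congr fun c => and_congr_right fun _ => ?_
    rw [← List.reverse_suffix]
    simp [hs, hpal]
  obtain ⟨v, -, hv, ⟨d, hd, l, hl⟩, hu⟩ := h
  obtain ⟨c, hc, A, hA⟩ := (hK2 d).1 hd
  have hw : applyM m w ++ o :: s = applyM m l ++ A ++ c :: (s ++ (applyM m v ++ o :: s)) := by
    have h1 : m d = A ++ c :: s := hA.symm
    rw [← hl, applyM_append, applyM_cons, h1]
    simp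
  refine ⟨s ++ (applyM m v ++ o :: s), ?_, ?_, ⟨c, hc, _, hw.symm⟩, ?_⟩
  · rw [List.mem_tails]
    exact ⟨applyM m l ++ A ++ [c], by rw [hw]; simp⟩
  · have := applyM_marker_reverse (o := o) hpal v
    rw [hv, ← hm] at this
    have h2 : s ++ (applyM m v ++ o :: s) = s ++ (applyM m v ++ [o]) ++ s := by simp
    rw [h2, List.reverse_append, List.reverse_append, this, hs]
    simp
  · rintro d' hd' c' hc' ⟨l', r', hlr⟩
    have hfull : applyM m (w ++ [y]) ++ [o]
        = (l' ++ d' :: s) ++ (applyM m v ++ o :: (s ++ c' :: (r' ++ z :: t))) := by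
      have : applyM m (w ++ [y]) ++ [o] = (applyM m w ++ o :: s) ++ z :: t := by
        simp [applyM_append, applyM_cons, applyM_nil, hm, hy]
      rw [this, ← hlr]
      simp
    obtain ⟨q, hq⟩ : ∃ q, applyM m v ++ o :: (s ++ c' :: (r' ++ z :: t)) = o :: q := by
      cases v with
      | nil => exact ⟨_, rfl⟩
      | cons a v => exact ⟨_, by rw [applyM_cons]; rfl⟩
    rw [hq] at hfull
    obtain ⟨w₁, w₂, hw12, hw₁, hw₂⟩ := exists_split_of_marker h0 hfull
    rw [← hq] at hw₂
    obtain ⟨w₃, rfl, hw₃⟩ := exists_append_of_image_prefix h0 hinj hw₂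
    cases w₃ with
    | nil => simp [applyM_nil] at hw₃
    | cons y' w₄ =>
    rcases List.eq_nil_or_concat w₁ with rfl | ⟨w₅, x, rfl⟩
    · simp [applyM_nil] at hw₁
    rw [List.concat_eq_append] at hw12 hw₁
    rw [applyM_cons] at hw₃
    simp only [List.cons_append, List.cons.injEq, List.append_assoc, true_and] at hw₃
    have hx : x ∈ K' := by
      refine (hK2 x).2 ⟨d', hd', ?_⟩
      have e : applyM m w₅ ++ o :: p x = l' ++ d' :: s := by
        rw [← hw₁, applyM_append, applyM_cons, applyM_nil, List.append_nil]
      rcases List.suffix_or_suffix_of_suffix (⟨l', e.symm⟩ : d' :: s <:+ _)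
        (⟨applyM m w₅, rfl⟩ : o :: p x <:+ applyM m w₅ ++ o :: p x) with h | h
      · exact h
      · rcases List.suffix_cons_iff.1 h with h | h
        · rw [h]
        · exact absurd (h.subset (by simp)) hos
    have hy' : y' ∈ K' := by
      refine (hK y').2 ⟨c', hc', ?_⟩
      obtain ⟨q', hq'⟩ := applyM_marker_head (o := o) (p := p) w₄
      rw [hq'] at hw₃
      rcases List.prefix_or_prefix_of_prefix
        (⟨r' ++ z :: t, by rw [hw₃]; simp⟩ : s ++ [c'] <+: p y' ++ o :: q')
        (⟨q', by simp⟩ : p y' ++ [o] <+: p y' ++ o :: q') with h | h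
      · exact h
      · rcases List.prefix_concat_iff.1 h with h | h
        · rw [h]
        · exact absurd (h.subset (by simp)) hos
    rcases List.eq_nil_or_concat w₄ with rfl | ⟨w₆, e, rfl⟩
    · have hlast : w ++ [y] = (w₅ ++ [x] ++ v) ++ [y'] := by rw [hw12]; simp
      obtain rfl : y = y' := by simpa using (List.append_inj' hlast rfl).2
      simp only [applyM_nil, List.nil_append, hy] at hw₃
      have := congrArg List.length hw₃
      simp at this
      omega
    · refine hu x hx y' hy' ⟨w₅, w₆, ?_⟩
      have hlast : w ++ [y] = (w₅ ++ x :: (v ++ y' :: w₆)) ++ [e] := by rw [hw12]; simp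
      rw [(List.append_inj' hlast rfl).1]
      simp

end Marked

/-! ### The morphisms `phim` and `taum` -/

/-- Every proper prefix of `w` of length at least 4 satisfies `HasNewCore` for each set of letters
that contains the next letter of `w`. -/
def NewCores (w : List (Fin 3)) : Prop :=
  ∀ (K : Finset (Fin 3)) (u r : List (Fin 3)) (z : Fin 3), w = u ++ z :: r → 4 ≤ u.length →
    z ∈ K → HasNewCore K u

/-- The part of `phim a` after its first letter. -/
def phiTail : Fin 3 → List (Fin 3) := ![[1], [2], [2, 2]]

/-- The part of `taum a` after its first letter. -/
def tauTail : Fin 3 → List (Fin 2) := ![[], [1], [1, 1]]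

theorem phim_eq : phim = fun a => 0 :: phiTail a := by
  funext a; fin_cases a <;> rfl

theorem taum_eq : taum = fun a => 0 :: tauTail a := by
  funext a; fin_cases a <;> rfl

theorem phiTail_prefix_palindrome :
    ∀ a, ∀ s ∈ (phiTail a).inits, s.reverse = s := by decide

theorem tauTail_prefix_palindrome :
    ∀ a, ∀ s ∈ (tauTail a).inits, s.reverse = s := by decide

theorem prefix_of_concat_eq {β : Type*} {u s t : List β} {o z : β}
    (h : u ++ [o] = s ++ z :: t) : s ∈ u.inits := by
  rw [List.mem_inits]
  exact List.prefix_of_prefix_length_le (⟨z :: t, h.symm⟩ : s <+: u ++ [o])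
    (List.prefix_append _ _) (by have := congrArg List.length h; simp at this; omega)

theorem hasNewCore_phi_initial : ∀ k ∈ Finset.Icc 4 9, ∀ K : Finset (Fin 3),
    ([0, 1, 0, 2, 0, 1, 0, 2, 2, 0] : List (Fin 3)).getD k 0 ∈ K →
      HasNewCore K (([0, 1, 0, 2, 0, 1, 0, 2, 2, 0] : List (Fin 3)).take k) := by
  decide +kernel

theorem phiTail_injective : Function.Injective phiTail := by decide

theorem tauTail_injective : Function.Injective tauTail := by decide

theorem four_le_length_of_image {β : Type*} {m : Fin 3 → List β} {u v : List (Fin 3)}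
    (hpre : [0, 1, 0, 2] <+: u ++ v)
    (h : (applyM m [0, 1, 0]).length < (applyM m u).length) : 4 ≤ u.length := by
  by_contra! hlt
  have h010 : [0, 1, 0] <+: u ++ v := List.IsPrefix.trans ⟨[2], rfl⟩ hpre
  obtain ⟨x, hx⟩ := List.prefix_of_prefix_length_le (List.prefix_append u v) h010
    (by simp; omega)
  rw [← hx, applyM_append, List.length_append] at h
  omega

theorem NewCores.phi {w : List (Fin 3)} (hpre : [0, 1, 0, 2] <+: w) (hw : NewCores w) :
    NewCores (applyM phim w) := by
  intro K u r z h hlen hz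
  have h' : applyM phim w ++ [0] = u ++ z :: (r ++ [0]) := by rw [h]; simp
  by_cases hu : u.length ≤ 9
  · have hL : [0, 1, 0, 2, 0, 1, 0, 2, 2, 0] <+: applyM phim w ++ [0] := by
      obtain ⟨x, rfl⟩ := hpre
      obtain ⟨q, hq⟩ := applyM_marker_head (o := 0) (p := phiTail) x
      rw [← phim_eq] at hq
      rw [applyM_append, List.append_assoc, hq]
      exact ⟨q, rfl⟩
    obtain ⟨q, hq⟩ := hL
    rw [h'] at hq
    have hk := hasNewCore_phi_initial u.length (Finset.mem_Icc.2 ⟨hlen, hu⟩) K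
    have e1 : ([0, 1, 0, 2, 0, 1, 0, 2, 2, 0] : List (Fin 3)).take u.length = u := by
      have := congrArg (List.take u.length) hq
      rwa [List.take_append_of_le_length (by simp; omega), List.take_left] at this
    have e2 : ([0, 1, 0, 2, 0, 1, 0, 2, 2, 0] : List (Fin 3)).getD u.length 0 = z := by
      have := congrArg (fun l => l.getD u.length 0) hq
      simpa only [List.getD_append _ _ _ _ (show u.length <
        ([0, 1, 0, 2, 0, 1, 0, 2, 2, 0] : List (Fin 3)).length by simp; omega),
        List.getD_append_right _ _ _ _ le_rfl, Nat.sub_self, List.getD_cons_zero] using this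
    rw [e1, e2] at hk
    exact hk hz
  · rw [phim_eq] at h'
    obtain ⟨w', y, w'', s, t, rfl, rfl, hy⟩ := exists_block h' (by rintro rfl; simp at hlen)
    have hsy := prefix_of_concat_eq hy
    have hw' : 4 ≤ w'.length := by
      refine four_le_length_of_image (m := phim) hpre ?_
      have hs2 := (List.mem_inits _ _ |>.1 hsy).length_le.trans
        ((by decide : ∀ a, (phiTail a).length ≤ 2) y)
      have h6 : (applyM phim [0, 1, 0]).length = 6 := rfl
      rw [h6, phim_eq]
      simp only [List.length_append, List.length_cons] at hu
      omega
    refine HasNewCore.image (by decide) (by decide) phiTail_injective hy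
      (phiTail_prefix_palindrome y s hsy)
      (K' := Finset.univ.filter fun x => ∃ c ∈ K, s ++ [c] <+: phiTail x ++ [0])
      (by simp) (hw _ w' w'' y rfl hw' ?_)
    simp only [Finset.mem_filter, Finset.mem_univ, true_and]
    exact ⟨z, hz, ⟨t, by rw [hy]; simp⟩⟩

theorem newCores_phipow (n : ℕ) :
    [0, 1, 0, 2] <+: phipow (n + 2) [0] ∧ NewCores (phipow (n + 2) [0]) := by
  induction n with
  | zero =>
    have h : phipow 2 [0] = [0, 1, 0, 2] := rfl
    rw [h]
    refine ⟨List.prefix_rfl, fun K u r z h hlen => ?_⟩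
    have := congrArg List.length h
    simp at this
    omega
  | succ n ih =>
    have h : phipow (n + 1 + 2) [0] = applyM phim (phipow (n + 2) [0]) :=
      Function.iterate_succ_apply' _ _ _
    rw [h]
    refine ⟨?_, ih.2.phi ih.1⟩
    obtain ⟨x, hx⟩ := ih.1
    rw [← hx, applyM_append]
    exact ⟨_, rfl⟩

theorem rich_tau_initial : ∀ k ≤ 8, Rich (([0, 0, 1, 0, 0, 1, 1, 0] : List (Fin 2)).take k) := by
  have h0 : Rich ([] : List (Fin 2)) := rich_nil
  have h1 : Rich ([0] : List (Fin 2)) :=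
    h0.concat (u := [0]) (by decide) (by decide) (by decide) (by decide)
  have h2 : Rich ([0, 0] : List (Fin 2)) :=
    h1.concat (u := [0, 0]) (by decide) (by decide) (by decide) (by decide)
  have h3 : Rich ([0, 0, 1] : List (Fin 2)) :=
    h2.concat (u := [1]) (by decide) (by decide) (by decide) (by decide)
  have h4 : Rich ([0, 0, 1, 0] : List (Fin 2)) :=
    h3.concat (u := [0, 1, 0]) (by decide) (by decide) (by decide) (by decide)
  have h5 : Rich ([0, 0, 1, 0, 0] : List (Fin 2)) :=
    h4.concat (u := [0, 0, 1, 0, 0]) (by decide) (by decide) (by decide) (by decide)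
  have h6 : Rich ([0, 0, 1, 0, 0, 1] : List (Fin 2)) :=
    h5.concat (u := [1, 0, 0, 1]) (by decide) (by decide) (by decide) (by decide)
  have h7 : Rich ([0, 0, 1, 0, 0, 1, 1] : List (Fin 2)) :=
    h6.concat (u := [1, 1]) (by decide) (by decide) (by decide) (by decide)
  have h8 : Rich ([0, 0, 1, 0, 0, 1, 1, 0] : List (Fin 2)) :=
    h7.concat (u := [0, 1, 1, 0]) (by decide) (by decide) (by decide) (by decide)
  intro k hk
  interval_cases k <;> assumption

theorem NewCores.rich_tau {w : List (Fin 3)} (hpre : [0, 1, 0, 2] <+: w) (hw : NewCores w) :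
    ∀ u r, applyM taum w ++ [0] = u ++ r → Rich u := by
  intro u
  induction u using List.reverseRecOn with
  | nil => exact fun _ _ => rich_nil
  | append_singleton u z ih =>
    intro r h'
    rw [List.append_assoc, List.singleton_append] at h'
    by_cases hu : u.length ≤ 7
    · have hL : [0, 0, 1, 0, 0, 1, 1, 0] <+: applyM taum w ++ [0] := by
        obtain ⟨x, rfl⟩ := hpre
        obtain ⟨q, hq⟩ := applyM_marker_head (o := 0) (p := tauTail) x
        rw [← taum_eq] at hq
        rw [applyM_append, List.append_assoc, hq]
        exact ⟨q, rfl⟩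
      have h1 : u ++ [z] <+: [0, 0, 1, 0, 0, 1, 1, 0] :=
        List.prefix_of_prefix_length_le ⟨r, by rw [h']; simp⟩ hL (by simp; omega)
      rw [List.prefix_iff_eq_take.1 h1]
      exact rich_tau_initial _ (by simp; omega)
    · refine (ih _ h').concat_of_hasNewCore ?_
      rw [taum_eq] at h'
      obtain ⟨w', y, w'', s, t, rfl, rfl, hy⟩ := exists_block h' (by rintro rfl; simp at hu)
      have hsy := prefix_of_concat_eq hy
      have hw' : 4 ≤ w'.length := by
        refine four_le_length_of_image (m := taum) hpre ?_
        have hs2 := (List.mem_inits _ _ |>.1 hsy).length_le.trans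
          ((by decide : ∀ a, (tauTail a).length ≤ 2) y)
        have h4 : (applyM taum [0, 1, 0]).length = 4 := rfl
        rw [h4, taum_eq]
        simp only [List.length_append, List.length_cons] at hu
        omega
      refine HasNewCore.image (by decide) (by decide) tauTail_injective hy
        (tauTail_prefix_palindrome y s hsy)
        (K' := Finset.univ.filter fun x => ∃ c ∈ ({z} : Finset (Fin 2)),
          s ++ [c] <+: tauTail x ++ [0])
        (by simp) (hw _ w' w'' y rfl hw' ?_)
      simp only [Finset.mem_filter, Finset.mem_univ, true_and]
      exact ⟨z, Finset.mem_singleton_self z, ⟨t, by rw [hy]; simp⟩⟩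

theorem stmt5 (n : ℕ) : Rich (applyM taum (phipow n [0])) := by
  match n with
  | 0 => exact rich_tau_initial 1 (by decide)
  | 1 => exact rich_tau_initial 3 (by decide)
  | n + 2 => exact (newCores_phipow n).2.rich_tau (newCores_phipow n).1 _ _ rfl
end

section
/- Every factor of every word τ(φ^n(0)) (n ≥ 0) is rich; that is, the infinite word r = τ(φ^ω(0)) is rich. -/
section PalindromicReturns

variable {α : Type*}

/-- Every factor of `w` that properly begins and ends with a nonempty palindrome `q` has a
palindromic suffix longer than `q`. -/
def PalReturns (w : List α) : Prop :=
  ∀ u q : List α, u <:+: w → q ≠ [] → q.reverse = q → q <+: u → q <:+ u → q.length < u.length →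
    ∃ P : List α, P.reverse = P ∧ P <:+ u ∧ q.length < P.length

theorem PalReturns.of_infix {w v : List α} (hw : PalReturns w) (hv : v <:+: w) : PalReturns v :=
  fun u q hu => hw u q (hu.trans hv)

theorem prefix_of_palindrome_suffix {q P : List α} (hq : q.reverse = q) (hP : P.reverse = P)
    (h : q <:+ P) : q <+: P := by
  rw [← hq, ← hP]
  exact List.reverse_prefix.mpr h

theorem exists_longest_palindrome_suffix (w : List α) (a : α) :
    ∃ P : List α, P ≠ [] ∧ P.reverse = P ∧ P <:+ w ++ [a] ∧
      ∀ Q : List α, Q.reverse = Q → Q <:+ w ++ [a] → Q.length ≤ P.length := by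
  classical
  let S : Set ℕ := {n | ∃ Q : List α, Q.reverse = Q ∧ Q <:+ w ++ [a] ∧ Q.length = n}
  have hfin : S.Finite := by
    refine (Set.finite_Iic (w ++ [a]).length).subset ?_
    rintro n ⟨Q, -, hQ, rfl⟩
    exact hQ.length_le
  have h1 : 1 ∈ S := ⟨[a], by simp, List.suffix_append _ _, rfl⟩
  obtain ⟨n, ⟨P, hP, hPs, rfl⟩, hmax⟩ := Set.exists_max_image S id hfin ⟨1, h1⟩
  refine ⟨P, ?_, hP, hPs, fun Q hQ hQs => hmax _ ⟨Q, hQ, hQs, rfl⟩⟩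
  rintro rfl
  simpa using hmax 1 h1

theorem PalReturns.finite_and_rich (w : List α) (hw : PalReturns w) :
    {u : List α | u ≠ [] ∧ u <:+: w ∧ u.reverse = u}.Finite ∧ Rich w := by
  induction w using List.reverseRecOn with
  | nil =>
    have : {u : List α | u ≠ [] ∧ u <:+: [] ∧ u.reverse = u} = ∅ := by
      ext u
      simp +contextual
    rw [Rich, this]
    simp
  | append_singleton w a ih =>
    obtain ⟨hfin, hcard⟩ := ih (hw.of_infix (List.prefix_append _ _).isInfix)
    obtain ⟨P, hP0, hP, hPs, hmax⟩ := exists_longest_palindrome_suffix w a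
    have hins : {u : List α | u ≠ [] ∧ u <:+: w ++ [a] ∧ u.reverse = u} =
        insert P {u : List α | u ≠ [] ∧ u <:+: w ∧ u.reverse = u} := by
      ext v
      simp only [Set.mem_ofPred_eq, Set.mem_insert_iff]
      constructor
      · rintro ⟨hv0, ⟨L, R, hv⟩, hvr⟩
        rcases List.eq_nil_or_concat R with rfl | ⟨R', c, rfl⟩
        · have hvs : v <:+ w ++ [a] := ⟨L, by simpa using hv⟩
          have hvP := List.suffix_of_suffix_length_le hvs hPs (hmax v hvr hvs)
          obtain ⟨k, hk⟩ := prefix_of_palindrome_suffix hvr hP hvP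
          rcases List.eq_nil_or_concat k with rfl | ⟨k', c, rfl⟩
          · left
            simpa using hk
          · right
            obtain ⟨m, hm⟩ := hPs
            refine ⟨hv0, ⟨m, k', ?_⟩, hvr⟩
            rw [← hk] at hm
            simp only [List.concat_eq_append, ← List.append_assoc] at hm
            simpa using (List.append_inj' hm rfl).1
        · right
          refine ⟨hv0, ⟨L, R', ?_⟩, hvr⟩
          simp only [List.concat_eq_append, ← List.append_assoc] at hv
          simpa using (List.append_inj' hv rfl).1
      · rintro (rfl | ⟨h0, h1, h2⟩)
        · exact ⟨hP0, hPs.isInfix, hP⟩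
        · exact ⟨h0, h1.trans (List.prefix_append _ _).isInfix, h2⟩
    have hnot : P ∉ {u : List α | u ≠ [] ∧ u <:+: w ∧ u.reverse = u} := by
      rintro ⟨-, ⟨L, R, hLR⟩, -⟩
      have hsuf : P ++ (R ++ [a]) <:+ w ++ [a] := ⟨L, by simp [← hLR]⟩
      obtain ⟨Q, hQ, hQs, hlen⟩ := hw (P ++ (R ++ [a])) P hsuf.isInfix hP0 hP
        (List.prefix_append _ _)
        (List.suffix_of_suffix_length_le hPs hsuf (by simp)) (by simp)
      exact absurd (hmax Q hQ (hQs.trans hsuf)) (by omega)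
    rw [Rich, hins]
    refine ⟨hfin.insert P, ?_⟩
    rw [Set.ncard_insert_of_notMem hnot hfin, hcard]
    simp

theorem exists_peel_palindrome {P l : List α} {c : α} (hP : P.reverse = P) (hs : P <:+ l ++ [c])
    (hlen : 2 ≤ P.length) : ∃ P', P = c :: P' ++ [c] ∧ P'.reverse = P' ∧ c :: P' <:+ l := by
  obtain ⟨m, hm⟩ := hs
  rcases List.eq_nil_or_concat P with rfl | ⟨Q, d, rfl⟩
  · simp at hlen
  simp only [List.concat_eq_append, ← List.append_assoc] at hm hP hlen ⊢
  have hd := (List.append_inj' hm rfl).2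
  have hml := (List.append_inj' hm rfl).1
  obtain rfl : d = c := by simpa using hd
  cases Q with
  | nil => simp at hlen
  | cons e P' =>
    simp only [List.reverse_append, List.reverse_cons, List.reverse_nil, List.nil_append,
      List.cons_append, List.cons.injEq] at hP
    obtain ⟨rfl, hP⟩ := hP
    exact ⟨P', rfl, (List.append_inj' hP rfl).1, ⟨m, hml⟩⟩

end PalindromicReturns

/-- The variant of `PalReturns` in which occurrences of a (possibly empty) palindrome `q` count
only when surrounded by nonzero letters. -/
def PaddedPalReturns (w : List (Fin 3)) : Prop :=
  ∀ (a b c d : Fin 3) (t q : List (Fin 3)), a ≠ 0 → b ≠ 0 → c ≠ 0 → d ≠ 0 →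
    a :: t ++ [b] <:+: w → q.reverse = q → q ++ [c] <+: t → d :: q <:+ t →
    ∃ (e : Fin 3) (P : List (Fin 3)), e ≠ 0 ∧ P.reverse = P ∧ e :: P <:+ a :: t ∧
      q.length < P.length

section Coding

variable {α : Type*}

/-- The blocks `p a` following the marker `z` in the images of letters: `p 1 = y`, `p 2 = yy`,
and `p 0` is empty or a single third letter. -/
structure IsBlockCoding (z y : α) (p : Fin 3 → List α) : Prop where
  ne : z ≠ y
  zero : p 0 = [] ∨ ∃ o, p 0 = [o] ∧ o ≠ z ∧ o ≠ y
  one : p 1 = [y]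
  two : p 2 = [y, y]

/-- The morphism `a ↦ z p(a)`. -/
def blockMap (z : α) (p : Fin 3 → List α) (w : List (Fin 3)) : List α :=
  applyM (fun a => z :: p a) w

@[simp] theorem blockMap_nil (z : α) (p : Fin 3 → List α) : blockMap z p [] = [] := rfl

@[simp] theorem blockMap_cons (z : α) (p : Fin 3 → List α) (a : Fin 3) (w : List (Fin 3)) :
    blockMap z p (a :: w) = z :: (p a ++ blockMap z p w) := by
  simp [blockMap, applyM]

@[simp] theorem blockMap_append (z : α) (p : Fin 3 → List α) (v w : List (Fin 3)) :
    blockMap z p (v ++ w) = blockMap z p v ++ blockMap z p w := by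
  simp [blockMap, applyM]

theorem exists_blockMap_append_eq_cons (z : α) (p : Fin 3 → List α) (w : List (Fin 3)) :
    ∃ r, blockMap z p w ++ [z] = z :: r := by
  cases w <;> simp

theorem length_blockMap_lt (z : α) (p : Fin 3 → List α) {v P : List (Fin 3)} (h : v <:+ P) (hlt : v.length < P.length) :
    (blockMap z p v).length < (blockMap z p P).length := by
  obtain ⟨m, rfl⟩ := h
  cases m with
  | nil => simp at hlt
  | cons c m => simp; omega

namespace IsBlockCoding

variable {z y : α} {p : Fin 3 → List α}

theorem marker_notMem (hp : IsBlockCoding z y p) (a : Fin 3) : z ∉ p a := by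
  have := hp.ne
  fin_cases a
  · rcases hp.zero with h | ⟨o, h, h1, h2⟩ <;> simp [h]
    exact h1.symm
  · simpa [hp.one]
  · simpa [hp.two]

theorem reverse_block (hp : IsBlockCoding z y p) (a : Fin 3) : (p a).reverse = p a := by
  fin_cases a
  · rcases hp.zero with h | ⟨o, h, h1, h2⟩ <;> simp [h]
  · simp [hp.one]
  · simp [hp.two]

theorem mem_block_iff (hp : IsBlockCoding z y p) (a : Fin 3) : y ∈ p a ↔ a ≠ 0 := by
  fin_cases a
  · rcases hp.zero with h | ⟨o, h, h1, h2⟩ <;> simp [h]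
    exact h2.symm
  · simp [hp.one]
  · simp [hp.two]

theorem block_injective (hp : IsBlockCoding z y p) : Function.Injective p := by
  intro a b hab
  have h0 : p 0 ≠ p 1 := by
    intro h
    have := (hp.mem_block_iff 0).1 (by simp [h, hp.one])
    exact this rfl
  have h1 : p 0 ≠ p 2 := by
    intro h
    have := (hp.mem_block_iff 0).1 (by simp [h, hp.two])
    exact this rfl
  have h2 : p 1 ≠ p 2 := by simp [hp.one, hp.two]
  fin_cases a <;> fin_cases b <;> first | rfl | (exfalso; simp_all)

theorem exists_block_eq_cons (hp : IsBlockCoding z y p)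
    {b : Fin 3} (hb : b ≠ 0) : ∃ r, p b = y :: r := by
  fin_cases b
  · exact absurd rfl hb
  · exact ⟨_, hp.one⟩
  · exact ⟨_, hp.two⟩

theorem exists_block_eq_append (hp : IsBlockCoding z y p)
    {b : Fin 3} (hb : b ≠ 0) : ∃ r, p b = r ++ [y] := by
  obtain ⟨r, hr⟩ := hp.exists_block_eq_cons hb
  exact ⟨r.reverse, by rw [← hp.reverse_block, hr]; simp⟩

theorem reverse_blockMap (hp : IsBlockCoding z y p) (w : List (Fin 3)) :
    (blockMap z p w ++ [z]).reverse = blockMap z p w.reverse ++ [z] := by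
  induction w with
  | nil => simp
  | cons a w ih =>
    have h : blockMap z p (a :: w) ++ [z] = z :: p a ++ (blockMap z p w ++ [z]) := by simp
    rw [h, List.reverse_append, ih]
    simp [hp.reverse_block]

/-- Occurrences of the marker are exactly the starts of blocks. -/
theorem exists_split_at_marker (hp : IsBlockCoding z y p) (w : List (Fin 3)) (L R : List α)
    (h : L ++ z :: R = blockMap z p w ++ [z]) :
    ∃ v v', w = v ++ v' ∧ L = blockMap z p v ∧ z :: R = blockMap z p v' ++ [z] := by
  induction w generalizing L with
  | nil =>
    cases L with
    | nil => exact ⟨[], [], rfl, rfl, by simpa using h⟩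
    | cons => simp at h
  | cons a w ih =>
    cases L with
    | nil => exact ⟨[], a :: w, rfl, rfl, by simpa using h⟩
    | cons c L =>
      simp only [List.cons_append, blockMap_cons, List.cons.injEq, List.append_assoc] at h
      obtain ⟨rfl, h⟩ := h
      rcases List.append_eq_append_iff.1 h with ⟨m, h1, h2⟩ | ⟨m, h1, h2⟩
      · cases m with
        | nil =>
          obtain ⟨v, v', rfl, h3, h4⟩ := ih [] (by simpa using h2)
          exact ⟨a :: v, v', rfl, by simp [← h3, h1], h4⟩
        | cons e m =>
          simp only [List.cons_append, List.cons.injEq] at h2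
          exact absurd (show c ∈ p a by simp [h1, ← h2.1]) (hp.marker_notMem a)
      · obtain ⟨v, v', rfl, h3, h4⟩ := ih m h2.symm
        exact ⟨a :: v, v', rfl, by simp [← h3, h1], h4⟩

theorem blockMap_injective (hp : IsBlockCoding z y p) : Function.Injective (blockMap z p) := by
  intro v
  induction v with
  | nil =>
    intro w h
    cases w with
    | nil => rfl
    | cons => simp at h
  | cons a v ih =>
    intro w h
    cases w with
    | nil => simp at h
    | cons b w =>
      simp only [blockMap_cons, List.cons.injEq, true_and] at h
      obtain ⟨r, hr⟩ := exists_blockMap_append_eq_cons z p v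
      obtain ⟨s, hs⟩ := exists_blockMap_append_eq_cons z p w
      have h' : p a ++ z :: r = p b ++ z :: s := by
        rw [← hr, ← hs, ← List.append_assoc, ← List.append_assoc, h]
      have hab : p a = p b := by
        have ha := hp.marker_notMem a
        have hb := hp.marker_notMem b
        rcases List.append_eq_append_iff.1 h' with ⟨m, h1, h2⟩ | ⟨m, h1, h2⟩ <;> cases m <;>
          simp_all
      rw [hab] at h
      rw [hp.block_injective hab, ih (List.append_cancel_left h)]

theorem palindrome_of_blockMap (hp : IsBlockCoding z y p) {v : List (Fin 3)}
    (h : (blockMap z p v ++ [z]).reverse = blockMap z p v ++ [z]) : v.reverse = v := by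
  rw [hp.reverse_blockMap] at h
  exact hp.blockMap_injective (List.append_cancel_right h)

theorem exists_of_marker_free (hp : IsBlockCoding z y p)
    (w : List (Fin 3)) (L E R : List α) (hE0 : E ≠ []) (hE : z ∉ E)
    (h : L ++ E ++ R = blockMap z p w ++ [z]) :
    ∃ a l r L' R', p a = l ++ E ++ r ∧ L = L' ++ z :: l ∧ R = r ++ z :: R' := by
  induction w generalizing L with
  | nil =>
    exfalso
    cases L with
    | nil =>
      cases E with
      | nil => exact hE0 rfl
      | cons e E => simp_all
    | cons c L => simp_all
  | cons a w ih =>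
    cases L with
    | nil =>
      exfalso
      cases E with
      | nil => exact hE0 rfl
      | cons e E => simp_all
    | cons c L =>
      simp only [List.cons_append, blockMap_cons, List.cons.injEq, List.append_assoc] at h
      obtain ⟨rfl, h⟩ := h
      rcases List.append_eq_append_iff.1 h with ⟨m, h1, h2⟩ | ⟨m, h1, h2⟩
      · obtain ⟨s, hs⟩ := exists_blockMap_append_eq_cons c p w
        rw [hs] at h2
        rcases List.append_eq_append_iff.1 h2 with ⟨k, h3, h4⟩ | ⟨k, h3, h4⟩
        · exact ⟨a, L, k, [], s, by simp [h1, h3], rfl, h4⟩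
        · cases k with
          | nil => exact ⟨a, L, [], [], s, by simpa [h1] using h3.symm, rfl, by simpa using h4.symm⟩
          | cons e k =>
            simp only [List.cons_append, List.cons.injEq] at h4
            exact absurd (show c ∈ E by simp [h3, ← h4.1]) hE
      · obtain ⟨a', l, r, L', R', h3, h4, h5⟩ := ih m (by simpa using h2.symm)
        exact ⟨a', l, r, c :: (p a ++ L'), R', h3, by simp [h1, h4], h5⟩

theorem exists_last_ne_zero (hp : IsBlockCoding z y p)
    {w : List (Fin 3)} {L : List α} (h : L ++ [y] = blockMap z p w) :
    ∃ v a, a ≠ 0 ∧ w = v ++ [a] := by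
  rcases List.eq_nil_or_concat w with rfl | ⟨v, a, rfl⟩
  · simp at h
  refine ⟨v, a, ?_, by simp⟩
  rintro rfl
  rcases hp.zero with h0 | ⟨o, h0, h1, h2⟩
  · have h' : L ++ [y] = blockMap z p v ++ [z] := by simpa [h0] using h
    have := (List.append_inj' h' rfl).2
    exact hp.ne (by simpa using this.symm)
  · have h' : L ++ [y] = (blockMap z p v ++ [z]) ++ [o] := by simpa [h0] using h
    have := (List.append_inj' h' rfl).2
    exact h2 (by simpa using this.symm)

theorem exists_head_ne_zero (hp : IsBlockCoding z y p) {w : List (Fin 3)} {R : List α}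
    (h : z :: y :: R = blockMap z p w ++ [z]) : ∃ b v, b ≠ 0 ∧ w = b :: v := by
  cases w with
  | nil => simp at h
  | cons b v =>
    refine ⟨b, v, ?_, rfl⟩
    rintro rfl
    rcases hp.zero with h0 | ⟨o, h0, h1, h2⟩
    · obtain ⟨r, hr⟩ := exists_blockMap_append_eq_cons z p v
      simp only [blockMap_cons, h0, List.nil_append, List.cons_append, hr, List.cons.injEq,
        true_and] at h
      exact hp.ne h.1.symm
    · simp only [blockMap_cons, h0, List.cons_append, List.cons.injEq, true_and] at h
      exact h2 h.1.symm

theorem exists_parse_of_marker (hp : IsBlockCoding z y p) {w : List (Fin 3)} {u : List α}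
    (hu : z :: u <:+: blockMap z p w ++ [z]) (hlast : [z] <:+ z :: u) :
    ∃ t, t <:+: w ∧ z :: u = blockMap z p t ++ [z] := by
  obtain ⟨L, R, h⟩ := hu
  obtain ⟨v, v', rfl, rfl, h2⟩ := hp.exists_split_at_marker w L (u ++ R) (by simpa using h)
  obtain ⟨m, hm⟩ := hlast
  have h3 : m ++ z :: R = blockMap z p v' ++ [z] := by
    rw [← h2, ← List.cons_append, ← hm]
    simp
  obtain ⟨t, t', rfl, rfl, -⟩ := hp.exists_split_at_marker v' m R h3
  exact ⟨t, ⟨v, t', by simp⟩, hm.symm⟩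

theorem exists_parse_padded (hp : IsBlockCoding z y p) {w : List (Fin 3)} {u : List α}
    (hu : y :: z :: u ++ [y] <:+: blockMap z p w ++ [z]) (hlast : [z] <:+ z :: u) :
    ∃ a t b, a ≠ 0 ∧ b ≠ 0 ∧ a :: t ++ [b] <:+: w ∧ z :: u = blockMap z p t ++ [z] := by
  obtain ⟨L, R, h⟩ := hu
  obtain ⟨v, v', rfl, h1, h2⟩ := hp.exists_split_at_marker w (L ++ [y]) (u ++ [y] ++ R)
    (by simpa using h)
  obtain ⟨m, hm⟩ := hlast
  have h3 : m ++ z :: (y :: R) = blockMap z p v' ++ [z] := by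
    have : z :: (u ++ [y] ++ R) = (z :: u) ++ (y :: R) := by simp
    rw [← h2, this, ← hm]
    simp
  obtain ⟨t, t', rfl, rfl, h4⟩ := hp.exists_split_at_marker v' m _ h3
  obtain ⟨v, a, ha, rfl⟩ := hp.exists_last_ne_zero h1
  obtain ⟨b, t', hb, rfl⟩ := hp.exists_head_ne_zero h4
  exact ⟨a, t, b, ha, hb, ⟨v, t', by simp⟩, hm.symm⟩

theorem palReturns_of_marker (hp : IsBlockCoding z y p)
    {w : List (Fin 3)} (hw : PalReturns w) {u q : List α}
    (hu : u <:+: blockMap z p w ++ [z]) (hq : (z :: q).reverse = z :: q) (hpre : z :: q <+: u)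
    (hsuf : z :: q <:+ u) (hlen : (z :: q).length < u.length) :
    ∃ P : List α, P.reverse = P ∧ P <:+ u ∧ (z :: q).length < P.length := by
  have hqlast : [z] <:+ z :: q := by
    rw [← hq]
    simp
  obtain ⟨s, -, hs⟩ := hp.exists_parse_of_marker (hpre.isInfix.trans hu) hqlast
  obtain ⟨m, hm⟩ := hpre
  obtain ⟨u, rfl⟩ : ∃ u', u = z :: u' := ⟨q ++ m, by simp [← hm]⟩
  obtain ⟨t, ht, hut⟩ := hp.exists_parse_of_marker hu (hqlast.trans hsuf)
  have hsr : s.reverse = s := hp.palindrome_of_blockMap (hs ▸ hq)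
  have hst : s <+: t := by
    rw [hs, hut] at hm
    obtain ⟨v, v', rfl, h1, -⟩ := hp.exists_split_at_marker t (blockMap z p s) m
      (by simpa using hm)
    rw [hp.blockMap_injective h1]
    exact List.prefix_append _ _
  have hts : s <:+ t := by
    obtain ⟨k, hk⟩ := hsuf
    rw [hut] at hk
    obtain ⟨v, v', rfl, -, h1⟩ := hp.exists_split_at_marker t k q hk
    rw [hs] at h1
    rw [hp.blockMap_injective (List.append_cancel_right h1)]
    exact List.suffix_append _ _
  have hlt : s.length < t.length := by
    refine lt_of_le_of_ne hts.length_le fun h => ?_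
    rw [hut, hs, hts.eq_of_length h] at hlen
    exact lt_irrefl _ hlen
  have key : ∃ P : List (Fin 3), P.reverse = P ∧ P <:+ t ∧ s.length < P.length := by
    by_cases h0 : s = []
    · subst h0
      rcases List.eq_nil_or_concat t with rfl | ⟨t', c, rfl⟩
      · simp at hlt
      · exact ⟨[c], by simp, by simp, by simp⟩
    · exact hw t s ht h0 hsr hst hts hlt
  obtain ⟨P, hP, ⟨k, hk⟩, hPlen⟩ := key
  refine ⟨blockMap z p P ++ [z], by rw [hp.reverse_blockMap, hP], ?_, ?_⟩
  · rw [hut, ← hk]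
    exact ⟨blockMap z p k, by simp⟩
  · rw [hs]
    have := length_blockMap_lt z p
      (List.suffix_of_suffix_length_le hts ⟨k, hk⟩ hPlen.le) hPlen
    simpa using this

theorem palReturns_of_forced (hp : IsBlockCoding z y p)
    {w : List (Fin 3)} (hw : PalReturns w) {u q E : List α}
    (hE : ∀ L R, L ++ E ++ R = blockMap z p w ++ [z] →
      (∃ L', L = L' ++ [z]) ∧ ∃ R', R = z :: R')
    (hEr : E.reverse = E) (hEq : E <+: q)
    (hu : u <:+: blockMap z p w ++ [z]) (hq : q.reverse = q) (hpre : q <+: u)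
    (hsuf : q <:+ u) (hlen : q.length < u.length) :
    ∃ P : List α, P.reverse = P ∧ P <:+ u ∧ q.length < P.length := by
  have hEq' : E <:+ q := by
    rw [← hEr, ← hq]
    exact List.reverse_suffix.mpr hEq
  obtain ⟨L, R, h⟩ := hu
  obtain ⟨m, hm⟩ := hEq.trans hpre
  obtain ⟨k, hk⟩ := hEq'.trans hsuf
  obtain ⟨L, rfl⟩ := (hE L (m ++ R) (by rw [← h, ← hm]; simp)).1
  obtain ⟨R, rfl⟩ := (hE ((L ++ [z]) ++ k) R (by rw [← h, ← hk]; simp)).2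
  have hpre' : z :: (q ++ [z]) <+: z :: u ++ [z] := by
    obtain ⟨m', hm'⟩ := hpre
    obtain ⟨q', hq'⟩ := hEq'
    obtain ⟨-, R', hR'⟩ := hE (L ++ [z] ++ q') (m' ++ z :: R) (by rw [← h, ← hm', ← hq']; simp)
    cases m' with
    | nil => simp [← hm'] at hlen
    | cons c m' =>
      simp only [List.cons_append, List.cons.injEq] at hR'
      obtain ⟨rfl, -⟩ := hR'
      exact ⟨m' ++ [c], by simp [← hm']⟩
  have hsuf' : z :: (q ++ [z]) <:+ z :: u ++ [z] := by
    obtain ⟨m', hm'⟩ := hsuf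
    obtain ⟨q', hq'⟩ := hEq
    obtain ⟨⟨L', hL'⟩, -⟩ := hE (L ++ [z] ++ m') (q' ++ z :: R) (by rw [← h, ← hm', ← hq']; simp)
    rcases List.eq_nil_or_concat m' with rfl | ⟨m', c, rfl⟩
    · simp [← hm'] at hlen
    · simp only [List.concat_eq_append, ← List.append_assoc] at hL'
      obtain rfl : c = z := by simpa using (List.append_inj' hL' rfl).2
      exact ⟨c :: m', by simp [← hm']⟩
  obtain ⟨P, hP, hPs, hPlen⟩ := hp.palReturns_of_marker hw (u := z :: u ++ [z]) (q := q ++ [z])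
    ⟨L, R, by simpa using h⟩ (by simp [hq]) hpre' hsuf' (by simpa using hlen)
  obtain ⟨P', rfl, hP', hPs'⟩ := exists_peel_palindrome hP hPs (by simp at hPlen; omega)
  refine ⟨P', hP', ?_, by simp at hPlen; omega⟩
  rcases List.suffix_cons_iff.1 hPs' with h1 | h1
  · simp at h1
    simp [h1]
  · exact (List.suffix_cons _ _).trans h1

theorem eq_of_adjacent (hp : IsBlockCoding z y p)
    {w : List (Fin 3)} {c d : α} (hc : c ≠ z) (hd : d ≠ z)
    (h : [c, d] <:+: blockMap z p w ++ [z]) : c = y ∧ d = y := by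
  obtain ⟨L, R, h⟩ := h
  obtain ⟨a, l, r, -, -, ha, -⟩ := hp.exists_of_marker_free w L [c, d] R (by simp)
    (by simp [hc.symm, hd.symm]) h
  have hlen := congrArg List.length ha
  fin_cases a
  · rcases hp.zero with h0 | ⟨o, h0, -⟩
    · simp [h0] at hlen
    · simp [h0] at hlen
      omega
  · simp [hp.one] at hlen
    omega
  · simp [hp.two] at hlen
    obtain rfl : l = [] := List.eq_nil_of_length_eq_zero (by omega)
    obtain rfl : r = [] := List.eq_nil_of_length_eq_zero (by omega)
    simp [hp.two] at ha
    exact ⟨ha.1.symm, ha.2.symm⟩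

theorem forced_pair (hp : IsBlockCoding z y p) (w : List (Fin 3)) (L R : List α)
    (h : L ++ [y, y] ++ R = blockMap z p w ++ [z]) :
    (∃ L', L = L' ++ [z]) ∧ ∃ R', R = z :: R' := by
  obtain ⟨a, l, r, L', R', ha, rfl, rfl⟩ := hp.exists_of_marker_free w L [y, y] R (by simp)
    (by simp [hp.ne]) h
  have hlen := congrArg List.length ha
  have : (p a).length ≤ 2 := by
    fin_cases a
    · rcases hp.zero with h0 | ⟨o, h0, -⟩ <;> simp [h0]
    · simp [hp.one]
    · simp [hp.two]
  simp at hlen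
  obtain rfl : l = [] := List.eq_nil_of_length_eq_zero (by omega)
  obtain rfl : r = [] := List.eq_nil_of_length_eq_zero (by omega)
  simp

theorem forced_single (hp : IsBlockCoding z y p)
    {o : α} (ho : o ≠ z) (ho' : o ≠ y) (w : List (Fin 3)) (L R : List α)
    (h : L ++ [o] ++ R = blockMap z p w ++ [z]) :
    (∃ L', L = L' ++ [z]) ∧ ∃ R', R = z :: R' := by
  obtain ⟨a, l, r, L', R', ha, rfl, rfl⟩ := hp.exists_of_marker_free w L [o] R (by simp)
    (by simp [ho.symm]) h
  have hmem : o ∈ p a := by simp [ha]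
  have hlen := congrArg List.length ha
  have : (p a).length ≤ 1 := by
    fin_cases a
    · rcases hp.zero with h0 | ⟨o, h0, -⟩ <;> simp [h0]
    · simp [hp.one]
    · simp [hp.two, ho'] at hmem
  simp at hlen
  obtain rfl : l = [] := List.eq_nil_of_length_eq_zero (by omega)
  obtain rfl : r = [] := List.eq_nil_of_length_eq_zero (by omega)
  simp

theorem palReturns_of_single (hp : IsBlockCoding z y p) {w : List (Fin 3)} {u : List α}
    (hu : u <:+: blockMap z p w ++ [z]) (hpre : [y] <+: u)
    (hsuf : [y] <:+ u) (hlen : 1 < u.length) :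
    ∃ P : List α, P.reverse = P ∧ P <:+ u ∧ 1 < P.length := by
  obtain ⟨v, hv, hvs⟩ : ∃ v, y ∉ v ∧ y :: v ++ [y] <:+ u := by
    obtain ⟨m, rfl⟩ := hsuf
    have hm : y ∈ m := by
      obtain ⟨k, hk⟩ := hpre
      cases m with
      | nil => simp at hlen
      | cons c m =>
        simp at hk
        simp [hk.1]
    obtain ⟨r, s, hrs, hr⟩ := List.eq_append_cons_of_mem (List.mem_reverse.2 hm)
    refine ⟨r.reverse, by simpa using hr, s.reverse, ?_⟩
    rw [List.reverse_eq_iff.1 hrs]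
    simp
  cases v with
  | nil => exact ⟨[y, y], rfl, hvs, by simp⟩
  | cons c v =>
    have hinf := hvs.isInfix.trans hu
    have hc : c = z := by
      by_contra hc
      have := hp.eq_of_adjacent (w := w) hp.ne.symm hc (List.IsInfix.trans ⟨[], v ++ [y], by simp⟩ hinf)
      simp [this.2] at hv
    subst hc
    have hlast : [c] <:+ c :: v := by
      rcases List.eq_nil_or_concat (c :: v) with h | ⟨m, d, h⟩
      · simp at h
      · simp only [List.concat_eq_append] at h
        rw [h] at hinf hv ⊢
        have hd : d = c := by
          by_contra hd
          have := hp.eq_of_adjacent (w := w) hd hp.ne.symm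
            (List.IsInfix.trans ⟨y :: m, [], by simp⟩ hinf)
          simp [this.1] at hv
        simp [hd]
    obtain ⟨a, t, b, -, -, -, ht⟩ := hp.exists_parse_padded (u := v) (by simpa using hinf) hlast
    have ht0 : ∀ e ∈ t, e = 0 := by
      intro e he
      by_contra he0
      obtain ⟨t1, t2, rfl⟩ := List.append_of_mem he
      refine hv ?_
      rw [ht]
      simp [(hp.mem_block_iff e).2 he0]
    have htr : t.reverse = t := by
      rw [List.eq_replicate_of_mem ht0]
      simp
    have hr : (c :: v).reverse = c :: v := by rw [ht, hp.reverse_blockMap, htr]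
    refine ⟨y :: (c :: v) ++ [y], ?_, hvs, by simp⟩
    rw [List.reverse_append, List.reverse_singleton, List.reverse_cons, hr]
    simp

theorem palReturns_of_padded (hp : IsBlockCoding z y p)
    {w : List (Fin 3)} (hw : PaddedPalReturns w) {u q : List α}
    (hu : u <:+: blockMap z p w ++ [z]) (hq : (y :: z :: q).reverse = y :: z :: q)
    (hpre : y :: z :: q <+: u)
    (hsuf : y :: z :: q <:+ u) (hlen : (y :: z :: q).length < u.length) :
    ∃ P : List α, P.reverse = P ∧ P <:+ u ∧ (y :: z :: q).length < P.length := by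
  obtain ⟨q', hq1, hq2, -⟩ := exists_peel_palindrome (l := (y :: z :: q).dropLast) (c := y) hq
    (by
      have h1 : (y :: z :: q).getLast (by simp) = y := by
        have := List.getLast_reverse (l := y :: z :: q) (by simp)
        simpa only [hq, List.head_cons] using this
      have h2 := List.dropLast_append_getLast (l := y :: z :: q) (by simp)
      rw [h1] at h2
      rw [h2]) (by simp)
  cases q' with
  | nil =>
    simp at hq1
    exact absurd hq1.1 hp.ne
  | cons c q' =>
    obtain ⟨rfl, rfl⟩ : z = c ∧ q = q' ++ [y] := by simpa using hq1
    have hlastq : [z] <:+ z :: q' := by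
      rw [← hq2]
      simp
    obtain ⟨-, v, -, -, -, -, hv⟩ := hp.exists_parse_padded (u := q')
      (by simpa using hpre.isInfix.trans hu) hlastq
    have hvr : v.reverse = v := hp.palindrome_of_blockMap (hv ▸ hq2)
    obtain ⟨u', rfl⟩ : ∃ u', u = y :: z :: u' ++ [y] := by
      obtain ⟨m, hm⟩ := hpre
      obtain ⟨k, hk⟩ := hsuf
      cases k with
      | nil => simp [← hk] at hlen
      | cons e k =>
        have h := hm.trans hk.symm
        simp only [List.cons_append, List.cons.injEq] at h
        cases k with
        | nil =>
          simp at h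
          exact absurd h.2.1 hp.ne
        | cons f k =>
          simp only [List.cons_append, List.cons.injEq] at h
          refine ⟨k ++ y :: z :: q', ?_⟩
          rw [← hk, ← h.1, ← h.2.1]
          simp
    have hlastu : [z] <:+ z :: u' := by
      obtain ⟨k, hk⟩ := hsuf
      obtain ⟨m, hm⟩ := hlastq
      have h : (k ++ y :: m ++ [z]) ++ [y] = (y :: z :: u') ++ [y] := by
        rw [← hk]
        have h2 : y :: z :: (q' ++ [y]) = y :: (z :: q') ++ [y] := by simp
        rw [h2, ← hm]
        simp
      have h' := (List.append_inj' h rfl).1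
      cases k with
      | nil =>
        simp only [List.nil_append, List.cons_append, List.cons.injEq, true_and] at h'
        exact ⟨m, h'⟩
      | cons e k =>
        simp only [List.cons_append, List.cons.injEq] at h'
        exact ⟨_, h'.2⟩
    obtain ⟨a, t, b, ha, hb, htw, ht⟩ := hp.exists_parse_padded hu hlastu
    have hq3 : y :: z :: (q' ++ [y]) = y :: (blockMap z p v ++ [z]) ++ [y] := by
      rw [← hv]
      simp
    have hu3 : y :: z :: u' ++ [y] = y :: (blockMap z p t ++ [z]) ++ [y] := by
      rw [← ht]
    rw [hq3, hu3] at hpre hsuf hlen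
    rw [hq3, hu3]
    obtain ⟨c, hc, hvc⟩ : ∃ c, c ≠ 0 ∧ v ++ [c] <+: t := by
      obtain ⟨m, hm⟩ := hpre
      rcases List.eq_nil_or_concat m with rfl | ⟨m, e, rfl⟩
      · simp [← hm] at hlen
      simp only [List.concat_eq_append, ← List.append_assoc] at hm
      have h := (List.append_inj' hm rfl).1
      simp only [List.cons_append, List.cons.injEq, true_and, List.append_assoc,
        List.nil_append] at h
      obtain ⟨v', t', rfl, h1, h2⟩ := hp.exists_split_at_marker t _ _ h
      obtain rfl := hp.blockMap_injective h1
      obtain ⟨c, s, hc, rfl⟩ := hp.exists_head_ne_zero h2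
      exact ⟨c, hc, s, by simp⟩
    obtain ⟨d, hd, hdv⟩ : ∃ d, d ≠ 0 ∧ d :: v <:+ t := by
      obtain ⟨m, hm⟩ := hsuf
      cases m with
      | nil =>
        rw [List.nil_append] at hm
        rw [hm] at hlen
        exact absurd hlen (lt_irrefl _)
      | cons e m =>
        have h := (List.append_inj' (s₁ := e :: m ++ y :: (blockMap z p v ++ [z]))
          ((List.append_assoc _ _ _).trans hm) rfl).1
        simp only [List.cons_append, List.cons.injEq] at h
        obtain ⟨r, hr⟩ := exists_blockMap_append_eq_cons z p v
        obtain ⟨t', v', rfl, h1, h2⟩ := hp.exists_split_at_marker t (m ++ [y]) r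
          (by rw [← h.2, hr]; simp)
        rw [← hr] at h2
        obtain rfl := hp.blockMap_injective (List.append_cancel_right h2)
        obtain ⟨s, d, hd, rfl⟩ := hp.exists_last_ne_zero h1
        exact ⟨d, hd, s, by simp⟩
    obtain ⟨e, P, he, hP, hPs, hPlen⟩ := hw a b c d t v ha hb hc hd htw hvr hvc hdv
    have hPt : P <:+ t := by
      rcases List.suffix_cons_iff.1 hPs with h | h
      · simp at h
        simp [h]
      · exact (List.suffix_cons _ _).trans h
    refine ⟨y :: (blockMap z p P ++ [z]) ++ [y], ?_, ?_, ?_⟩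
    · rw [List.reverse_append, List.reverse_singleton, List.reverse_cons, hp.reverse_blockMap, hP]
      simp
    · rcases List.suffix_cons_iff.1 hPs with h | ⟨k, hk⟩
      · simp only [List.cons.injEq] at h
        rw [h.2]
      · obtain ⟨r, hr⟩ := hp.exists_block_eq_append he
        exact ⟨y :: (blockMap z p k ++ z :: r), by simp [← hk, hr]⟩
    · have := length_blockMap_lt z p
        (List.suffix_of_suffix_length_le ((List.suffix_cons _ _).trans hdv) hPt hPlen.le) hPlen
      simpa using this

theorem palReturns_blockMap (hp : IsBlockCoding z y p)
    {w : List (Fin 3)} (hw : PalReturns w) (hw' : PaddedPalReturns w) :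
    PalReturns (blockMap z p w ++ [z]) := by
  intro u q hu hq0 hq hpre hsuf hlen
  rcases q with _ | ⟨c, q⟩
  · exact absurd rfl hq0
  by_cases hcz : c = z
  · subst hcz
    exact hp.palReturns_of_marker hw hu hq hpre hsuf hlen
  by_cases hcy : c = y
  · subst hcy
    rcases q with _ | ⟨d, q⟩
    · exact hp.palReturns_of_single hu hpre hsuf hlen
    by_cases hdz : d = z
    · subst hdz
      exact hp.palReturns_of_padded hw' hu hq hpre hsuf hlen
    · obtain rfl := (hp.eq_of_adjacent (w := w) hcz hdz
        (List.IsInfix.trans ⟨[], q, by simp⟩ (hpre.isInfix.trans hu))).2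
      exact hp.palReturns_of_forced hw (E := [d, d]) (hp.forced_pair w) (by simp)
        ⟨q, by simp⟩ hu hq hpre hsuf hlen
  · exact hp.palReturns_of_forced hw (E := [c]) (hp.forced_single hcz hcy w) (by simp)
      ⟨q, by simp⟩ hu hq hpre hsuf hlen

end IsBlockCoding

end Coding

theorem applyM_phim (w : List (Fin 3)) :
    applyM phim w = blockMap 0 ![[1], [2], [2, 2]] w := by
  unfold blockMap
  congr 1
  funext a
  fin_cases a <;> rfl

theorem applyM_taum (w : List (Fin 3)) :
    applyM taum w = blockMap 0 ![[], [1], [1, 1]] w := by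
  unfold blockMap
  congr 1
  funext a
  fin_cases a <;> rfl

theorem isBlockCoding_phim :
    IsBlockCoding (0 : Fin 3) 2 ![[1], [2], [2, 2]] :=
  ⟨by decide, Or.inr ⟨1, rfl, by decide, by decide⟩, rfl, rfl⟩

theorem isBlockCoding_taum :
    IsBlockCoding (0 : Fin 2) 1 ![[], [1], [1, 1]] :=
  ⟨by decide, Or.inl rfl, rfl, rfl⟩

theorem ne_zero_of_infix_applyM_phim {w : List (Fin 3)} {c : Fin 3}
    (h : [c, 0] <:+: applyM phim w) : c ≠ 0 := by
  rintro rfl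
  rw [applyM_phim] at h
  obtain ⟨L, R, h⟩ := h.trans (List.prefix_append _ [0]).isInfix
  obtain ⟨v, v', rfl, -, h2⟩ := isBlockCoding_phim.exists_split_at_marker w L (0 :: R)
    (by simpa using h)
  cases v' with
  | nil => simp at h2
  | cons a v' => fin_cases a <;> simp at h2

theorem paddedPalReturns_applyM_phim {w : List (Fin 3)} (h : PalReturns (applyM phim w)) :
    PaddedPalReturns (applyM phim w) := by
  have adj : ∀ c d : Fin 3, c ≠ 0 → d ≠ 0 → [c, d] <:+: applyM phim w → c = 2 ∧ d = 2 := by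
    intro c d hc hd hcd
    rw [applyM_phim] at hcd
    exact isBlockCoding_phim.eq_of_adjacent hc hd (hcd.trans (List.prefix_append _ _).isInfix)
  intro a b c d t q ha hb hc hd hinf hq hpre hsuf
  have hlen : q.length < t.length := by
    have := hpre.length_le
    simp at this
    omega
  have hqt : q <+: t := (List.prefix_append _ _).trans hpre
  have htq : q <:+ t := (List.suffix_cons _ _).trans hsuf
  by_cases hq0 : ∃ q', q = 0 :: q'
  · obtain ⟨q', rfl⟩ := hq0
    obtain ⟨P, hP, hPt, hPlen⟩ := h t (0 :: q') (List.IsInfix.trans ⟨[a], [b], by simp⟩ hinf)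
      (by simp) hq hqt htq hlen
    obtain ⟨k, hk⟩ := prefix_of_palindrome_suffix hq hP
      (List.suffix_of_suffix_length_le htq hPt hPlen.le)
    obtain ⟨m, hm⟩ := hPt
    rcases List.eq_nil_or_concat (a :: m) with h0 | ⟨m', e, h0⟩
    · simp at h0
    have hm' : m' ++ e :: P = a :: t := by
      rw [← hm, ← List.cons_append, h0]
      simp
    refine ⟨e, P, ?_, hP, ⟨m', hm'⟩, hPlen⟩
    refine ne_zero_of_infix_applyM_phim (w := w)
      (List.IsInfix.trans ⟨m', q' ++ k ++ [b], ?_⟩ hinf)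
    rw [← hm', ← hk]
    simp
  · obtain ⟨rfl, rfl, rfl, rfl⟩ : a = 2 ∧ b = 2 ∧ c = 2 ∧ d = 2 := by
      obtain ⟨m, hm⟩ := hpre
      obtain ⟨k, hk⟩ := hsuf
      cases q with
      | nil =>
        have h1 := adj a c ha hc (List.IsInfix.trans ⟨[], m ++ [b], by simp [← hm]⟩ hinf)
        have h2 := adj d b hd hb (List.IsInfix.trans ⟨a :: k, [], by simp [← hk]⟩ hinf)
        exact ⟨h1.1, h2.2, h1.2, h2.1⟩
      | cons g q' =>
        have hg : g ≠ 0 := fun hg => hq0 ⟨q', by rw [hg]⟩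
        obtain ⟨s, hs⟩ : ∃ s, g :: q' = s ++ [g] := ⟨q'.reverse, by rw [← hq]; simp⟩
        have h1 := adj a g ha hg
          (List.IsInfix.trans ⟨[], q' ++ [c] ++ m ++ [b], by simp [← hm]⟩ hinf)
        have h2 := adj d g hd hg (List.IsInfix.trans ⟨a :: k, q' ++ [b], by simp [← hk]⟩ hinf)
        rw [hs] at hm hk
        have h3 := adj g c hg hc
          (List.IsInfix.trans ⟨a :: s, m ++ [b], by simp [← hm]⟩ hinf)
        have h4 := adj g b hg hb
          (List.IsInfix.trans ⟨a :: (k ++ d :: s), [], by simp [← hk]⟩ hinf)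
        exact ⟨h1.1, h4.2, h3.2, h2.1⟩
    obtain ⟨m, hm⟩ := hpre
    obtain ⟨k, hk⟩ := hsuf
    obtain ⟨P, hP, hPs, hPlen⟩ := h (2 :: t ++ [2]) (2 :: q ++ [2]) hinf (by simp) (by simp [hq])
      ⟨m ++ [2], by simp [← hm]⟩ ⟨2 :: k, by simp [← hk]⟩ (by simpa using hlen)
    obtain ⟨P', rfl, hP', hPs'⟩ := exists_peel_palindrome hP hPs (by simp at hPlen; omega)
    exact ⟨2, P', by decide, hP', hPs', by simpa using hPlen⟩

theorem palReturns_phipow (n : ℕ) :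
    PalReturns (phipow n [0]) ∧ PaddedPalReturns (phipow n [0]) := by
  induction n with
  | zero =>
    constructor
    · intro u q hu hq0 _ _ _ hlen
      have h1 := hu.length_le
      have h2 := List.length_pos_iff.2 hq0
      simp [phipow] at h1
      omega
    · intro a b c d t q _ _ _ _ hinf
      have := hinf.length_le
      simp [phipow] at this
  | succ n ih =>
    have hs : phipow (n + 1) [0] = applyM phim (phipow n [0]) :=
      Function.iterate_succ_apply' _ _ _
    have h : PalReturns (applyM phim (phipow n [0])) := by
      rw [applyM_phim]
      exact (isBlockCoding_phim.palReturns_blockMap ih.1 ih.2).of_infix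
        (List.prefix_append _ _).isInfix
    rw [hs]
    exact ⟨h, paddedPalReturns_applyM_phim h⟩

theorem stmt6 (n : ℕ) (u : List (Fin 2))
    (hu : u <:+: applyM taum (phipow n [0])) : Rich u := by
  obtain ⟨h1, h2⟩ := palReturns_phipow n
  rw [applyM_taum] at hu
  exact (((isBlockCoding_taum.palReturns_blockMap h1 h2).of_infix
    (List.prefix_append _ _).isInfix).of_infix hu).finite_and_rich.2
end

section
/- For every n ≥ 0, every nonempty factor w of τ(φ^n(0)) and every period p of w satisfy |w|/p < 2 + √2/2 (as real numbers). In other words, the infinite word r = τ(φ^ω(0)) contains no factor of exponent ≥ 2 + √2/2. -/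
/-- `p` is a period of the finite word `w`: `1 ≤ p ≤ |w|` and `w[i] = w[i+p]`
for all valid indices. -/
def IsPeriod {α : Type*} (w : List α) (p : ℕ) : Prop :=
  0 < p ∧ p ≤ w.length ∧ ∀ i : ℕ, i + p < w.length → w[i]? = w[i+p]?

/-! ### The word `r` as a coding of a rotation -/

/-- The binary letter read at the point `y` of the circle `ℝ / 2ℤ`. -/
noncomputable def bit (y : ℝ) : Fin 2 := if Even ⌊y⌋ then 0 else 1

lemma bit_eq_zero {y : ℝ} (k : ℤ) (h₁ : 2 * k ≤ y) (h₂ : y < 2 * k + 1) : bit y = 0 := by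
  have : ⌊y⌋ = 2 * k := by
    rw [Int.floor_eq_iff]; push_cast; exact ⟨h₁, h₂⟩
  simp [bit, this]

lemma bit_eq_one {y : ℝ} (k : ℤ) (h₁ : 2 * k + 1 ≤ y) (h₂ : y < 2 * k + 2) : bit y = 1 := by
  have : ⌊y⌋ = 2 * k + 1 := by
    rw [Int.floor_eq_iff]; push_cast; exact ⟨h₁, by linarith⟩
  have h : ¬ Even (2 * k + 1) := by simp
  simp [bit, this, h]

lemma bit_eq_bit_iff (x y : ℝ) : bit x = bit y ↔ (Even ⌊x⌋ ↔ Even ⌊y⌋) := by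
  unfold bit
  split_ifs <;> simp [*]

/-- `v` is the coding of the orbit of `y` under the rotation `y ↦ y + √2`. -/
def IsRotationCoding : ℝ → List (Fin 2) → Prop
  | _, [] => True
  | y, b :: v => b = bit y ∧ IsRotationCoding (y + √2) v

lemma IsRotationCoding.getElem? {v : List (Fin 2)} {y : ℝ} (h : IsRotationCoding y v) {i : ℕ}
    (hi : i < v.length) : v[i]? = some (bit (y + i * √2)) := by
  induction v generalizing y i with
  | nil => simp at hi
  | cons b v ih =>
    obtain ⟨hb, hv⟩ := h
    cases i with
    | zero => simp [hb]
    | succ i =>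
      have := ih hv (i := i) (by simpa using hi)
      rw [List.getElem?_cons_succ, this]
      push_cast
      ring_nf

/-- Left endpoints of the intervals of the exchange of three intervals that is coded by the
fixed point of `phim`. -/
noncomputable def leftEnd : Fin 3 → ℝ := ![-1 / 2, -(3 + 2 * √2) / 2, -(3 + √2) / 2]

/-- Right endpoints of the exchanged intervals. -/
noncomputable def rightEnd : Fin 3 → ℝ := ![(1 + √2) / 2, -(3 + √2) / 2, -1 / 2]

/-- Translations of the exchanged intervals. -/
noncomputable def translation : Fin 3 → ℝ := ![-1 - √2, 2 + √2, 1]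

/-- `u` is the coding of the orbit of `z` under the exchange of three intervals. -/
def IsExchangeCoding : ℝ → List (Fin 3) → Prop
  | _, [] => True
  | z, c :: u => (leftEnd c < z ∧ z < rightEnd c) ∧ IsExchangeCoding (z + translation c) u

lemma sqrt_two_bounds : √2 * √2 = 2 ∧ 1.414 < √2 ∧ √2 < 1.415 := by
  refine ⟨by norm_num, ?_, ?_⟩
  · rw [Real.lt_sqrt] <;> norm_num
  · rw [Real.sqrt_lt'] <;> norm_num

lemma IsExchangeCoding.applyM_phim {u : List (Fin 3)} {z : ℝ} (h : IsExchangeCoding z u) :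
    IsExchangeCoding ((1 - √2) * z) (applyM phim u) := by
  induction u generalizing z with
  | nil => trivial
  | cons c u ih =>
    obtain ⟨⟨h₁, h₂⟩, hu⟩ := h
    obtain ⟨hr, hr₁, hr₂⟩ := sqrt_two_bounds
    have ih' := ih hu
    have e₁ := mul_pos (sub_pos.2 h₁) (show 0 < √2 - 1 by linarith)
    have e₂ := mul_pos (sub_pos.2 h₂) (show 0 < √2 - 1 by linarith)
    fin_cases c
    all_goals
      simp [applyM, phim, IsExchangeCoding, leftEnd, rightEnd, translation] at e₁ e₂ ih' ⊢
    · refine ⟨⟨by nlinarith, by nlinarith⟩, ⟨by nlinarith, by nlinarith⟩, ?_⟩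
      convert ih' using 1
      linear_combination -hr
    · refine ⟨⟨by nlinarith, by nlinarith⟩, ⟨by nlinarith, by nlinarith⟩, ?_⟩
      convert ih' using 1
      linear_combination hr
    · refine ⟨⟨by nlinarith, by nlinarith⟩, ⟨by nlinarith, by nlinarith⟩,
        ⟨by nlinarith, by nlinarith⟩, ?_⟩
      convert ih' using 1
      ring

lemma IsExchangeCoding.applyM_taum {u : List (Fin 3)} {z : ℝ} (h : IsExchangeCoding z u) (k : ℤ) :
    IsRotationCoding ((3 * √2 - 4) * z + √2 / 2 + 2 * k) (applyM taum u) := by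
  induction u generalizing z k with
  | nil => trivial
  | cons c u ih =>
    obtain ⟨⟨h₁, h₂⟩, hu⟩ := h
    obtain ⟨hr, hr₁, hr₂⟩ := sqrt_two_bounds
    have ih' := fun k => ih hu k
    have e₁ := mul_pos (sub_pos.2 h₁) (show 0 < 3 * √2 - 4 by linarith)
    have e₂ := mul_pos (sub_pos.2 h₂) (show 0 < 3 * √2 - 4 by linarith)
    fin_cases c
    all_goals
      simp [applyM, taum, IsRotationCoding, leftEnd, rightEnd, translation] at e₁ e₂ ih' ⊢
    · refine ⟨(bit_eq_zero k (by nlinarith) (by nlinarith)).symm, ?_⟩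
      convert ih' (k + 1) using 1
      push_cast
      linear_combination 3 * hr
    · refine ⟨(bit_eq_zero k (by nlinarith) (by nlinarith)).symm,
        (bit_eq_one k (by nlinarith) (by nlinarith)).symm, ?_⟩
      convert ih' (k + 1) using 1
      push_cast
      linear_combination -3 * hr
    · refine ⟨(bit_eq_zero k (by nlinarith) (by nlinarith)).symm,
        (bit_eq_one k (by nlinarith) (by nlinarith)).symm,
        (bit_eq_one (k + 1) (by push_cast; nlinarith) (by push_cast; nlinarith)).symm, ?_⟩
      convert ih' (k + 2) using 1
      push_cast
      ring

lemma isExchangeCoding_phipow (n : ℕ) : IsExchangeCoding 0 (phipow n [0]) := by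
  induction n with
  | zero =>
    have := sqrt_two_bounds.2.1
    simp [phipow, IsExchangeCoding, leftEnd, rightEnd]
    constructor <;> linarith
  | succ n ih =>
    rw [phipow, Function.iterate_succ_apply', ← mul_zero (1 - √2)]
    exact ih.applyM_phim

lemma isRotationCoding_phipow (n : ℕ) :
    IsRotationCoding (√2 / 2) (applyM taum (phipow n [0])) := by
  simpa using (isExchangeCoding_phipow n).applyM_taum 0

/-! ### Pell numbers -/

/-- The pairs `(P, H)` of Pell and half-companion Pell numbers. -/
def pell : ℕ → ℕ × ℕ
  | 0 => (0, 1)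
  | k + 1 => ((pell k).1 + (pell k).2, 2 * (pell k).1 + (pell k).2)

lemma pell_snd_sub (k : ℕ) : ((pell k).2 : ℝ) - √2 * (pell k).1 = (1 - √2) ^ k := by
  induction k with
  | zero => simp [pell]
  | succ k ih =>
    rw [pow_succ, ← ih]
    simp only [pell]
    push_cast
    linear_combination -((pell k).1 : ℝ) * sqrt_two_bounds.1

lemma pell_snd_pos (k : ℕ) : 0 < (pell k).2 := by
  induction k with
  | zero => simp [pell]
  | succ k ih => simp only [pell]; omega

lemma exists_pell_le_lt {p : ℕ} (hp : 0 < p) :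
    ∃ k, 0 < k ∧ (pell k).2 ≤ p ∧ p < (pell (k + 1)).2 := by
  have hfin : ∃ k, p < (pell (k + 1)).2 := by
    have h : ∀ k, k < (pell (k + 1)).2 := by
      intro k
      induction k with
      | zero => simp [pell]
      | succ k ih =>
        have := pell_snd_pos k
        simp only [pell] at ih ⊢
        omega
    exact ⟨p, h p⟩
  classical
  obtain ⟨k, hk, hmin⟩ := Nat.findX hfin
  rcases k with _ | k
  · simp [pell] at hk; omega
  · exact ⟨k + 1, by omega, not_lt.1 (hmin k (by omega)), hk⟩

lemma pell_det (k : ℕ) :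
    ((pell (k + 1)).1 * (pell k).2 - (pell k).1 * (pell (k + 1)).2 : ℤ) = (-1) ^ k := by
  induction k with
  | zero => simp [pell]
  | succ k ih =>
    rw [pow_succ, ← ih]
    simp only [pell]
    push_cast
    ring

/-- Among `1 ≤ p < H (k + 1)`, the distance from `p * √2` to the even integers is least at
`p = H k`. -/
lemma pell_best_approx {k p : ℕ} (hp : 0 < p) (hk : p < (pell (k + 1)).2) (q : ℤ) :
    √2 * (√2 - 1) ^ k ≤ |p * √2 - 2 * q| := by
  obtain ⟨hr, hr₁, hr₂⟩ := sqrt_two_bounds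
  have hdet := pell_det k
  have hk₁ := pell_snd_sub k
  have hk₂ := pell_snd_sub (k + 1)
  have hH := pell_snd_pos k
  set P := (pell k).1
  set H := (pell k).2
  set P' := (pell (k + 1)).1
  set H' := (pell (k + 1)).2
  obtain ⟨ε, hε, hεk⟩ : ∃ ε : ℤ, ε * ε = 1 ∧ (-1) ^ k = ε :=
    ⟨(-1) ^ k, by rw [← mul_pow]; simp, rfl⟩
  rw [hεk] at hdet
  have hν : (1 - √2) ^ k = ε * (√2 - 1) ^ k := by
    rw [← hεk]; push_cast; rw [← mul_pow]; ring
  rw [pow_succ] at hk₂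
  rw [hν] at hk₁ hk₂
  obtain ⟨u, hu⟩ : ∃ u : ℤ, u = ε * (p * P' - q * H') := ⟨_, rfl⟩
  obtain ⟨v, hv⟩ : ∃ v : ℤ, v = ε * (q * H - p * P) := ⟨_, rfl⟩
  have hpuv : (p : ℤ) = u * H + v * H' := by
    rw [hu, hv]; linear_combination -(p : ℤ) * hε - ε * p * hdet
  have hquv : q = u * P + v * P' := by
    rw [hu, hv]; linear_combination -q * hε - ε * q * hdet
  have hval : p * √2 - 2 * q = ε * (√2 * (√2 - 1) ^ k * (u - v * (√2 - 1))) := by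
    have h₁ : (p : ℝ) = u * H + v * H' := by exact_mod_cast hpuv
    have h₂ : (q : ℝ) = u * P + v * P' := by exact_mod_cast hquv
    rw [h₁, h₂]
    linear_combination √2 * u * hk₁ + √2 * v * hk₂ + (u * P + v * P') * hr
  have hεabs : |(ε : ℝ)| = 1 := by
    rcases mul_self_eq_one_iff.1 hε with rfl | rfl <;> simp
  have hpos : 0 < √2 * (√2 - 1) ^ k := by
    have : 0 < √2 - 1 := by linarith
    positivity
  rw [hval, abs_mul, hεabs, one_mul, abs_mul, abs_of_pos hpos]
  refine le_mul_of_one_le_right hpos.le ?_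
  have hpH : (p : ℤ) < H' := by exact_mod_cast hk
  have hp' : (0 : ℤ) < p := by exact_mod_cast hp
  have hH' : (0 : ℤ) < H := by exact_mod_cast hH
  have hcase : (1 ≤ u ∧ v ≤ 0) ∨ (u ≤ -1 ∧ 0 ≤ v) := by
    rcases lt_trichotomy u 0 with h | h | h
    · right; refine ⟨by omega, ?_⟩; by_contra!; nlinarith
    · exfalso
      subst h
      rcases le_or_gt v 0 with h' | h' <;> nlinarith
    · left; refine ⟨by omega, ?_⟩; by_contra!; nlinarith
  rcases hcase with ⟨h₁, h₂⟩ | ⟨h₁, h₂⟩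
  · have h₁ : (1 : ℝ) ≤ u := by exact_mod_cast h₁
    have h₂ : (v : ℝ) ≤ 0 := by exact_mod_cast h₂
    rw [abs_of_nonneg] <;> nlinarith
  · have h₁ : (u : ℝ) ≤ -1 := by exact_mod_cast h₁
    have h₂ : 0 ≤ (v : ℝ) := by exact_mod_cast h₂
    rw [abs_of_nonpos] <;> nlinarith

/-! ### Return times of the rotation -/

/-- If every point of a finite family can be moved to another point of the family, modulo `1`,
by a step to the right of length at most `δ`, then the family meets every interval of length `δ`
modulo `1`. -/
lemma exists_mem_interval_of_steps {N : ℕ} (hN : 0 < N) {f : ℕ → ℝ} {e δ : ℝ} (he : 0 < e)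
    (hf : ∀ i < N, ∃ j < N, ∃ m : ℤ, e ≤ f j + m - f i ∧ f j + m - f i ≤ δ) (c : ℝ) :
    ∃ i < N, ∃ m : ℤ, c ≤ f i + m ∧ f i + m ≤ c + δ := by
  have key : ∀ n : ℕ, ∀ i < N, ∀ m : ℤ, f i + m < c → c ≤ f i + m + n * e →
      ∃ i < N, ∃ m : ℤ, c ≤ f i + m ∧ f i + m ≤ c + δ := by
    intro n
    induction n with
    | zero => intro i _ m h₁ h₂; simp at h₂; linarith
    | succ n ih =>
      intro i hi m h₁ h₂
      obtain ⟨j, hj, m', h₃, h₄⟩ := hf i hi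
      push_cast at h₂
      rcases le_or_gt c (f j + (m + m' : ℤ)) with h | h
      · exact ⟨j, hj, m + m', h, by push_cast; linarith⟩
      · exact ih j hj (m + m') h (by push_cast; linarith)
  obtain ⟨n, hn⟩ := exists_nat_ge ((c - (f 0 + (⌊c - f 0⌋ - 1 : ℤ))) / e)
  rw [div_le_iff₀ he] at hn
  refine key n 0 hN (⌊c - f 0⌋ - 1) ?_ (by linarith)
  push_cast
  linarith [Int.floor_le (c - f 0)]

/-- Any `P (k + 1)` consecutive points of the rotation by `√2` meet every interval of length
`√2 * (√2 - 1) ^ k` modulo `1`. -/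
lemma exists_rotation_mem_interval (k : ℕ) (y c : ℝ) :
    ∃ i < (pell (k + 1)).1, ∃ m : ℤ, c ≤ y + i * √2 + m ∧
      y + i * √2 + m ≤ c + √2 * (√2 - 1) ^ k := by
  obtain ⟨hr, hr₁, hr₂⟩ := sqrt_two_bounds
  have hk₁ := pell_snd_sub k
  have hk₂ := pell_snd_sub (k + 1)
  have hPP : (pell k).1 < (pell (k + 1)).1 := by
    have := pell_snd_pos k
    simp only [pell]; omega
  rw [pow_succ] at hk₂
  set P := (pell k).1
  set H := (pell k).2
  set P' := (pell (k + 1)).1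
  set H' := (pell (k + 1)).2
  have hν : 0 < (√2 - 1) ^ k := pow_pos (by linarith) k
  have hν' : (1 - √2) ^ k = (-1) ^ k * (√2 - 1) ^ k := by
    rw [← mul_pow]; ring
  rw [hν'] at hk₁ hk₂
  set ν := (√2 - 1) ^ k
  have step : ∀ i < P', ∃ j < P', ∃ m : ℤ,
      ((j - i) * √2 + m = -((-1) ^ k * ν) ∨ (j - i) * √2 + m = -((-1) ^ k * (√2 * ν))) := by
    intro i hi
    rcases lt_or_ge (i + P) P' with h | h
    · refine ⟨i + P, h, -H, Or.inl ?_⟩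
      push_cast
      linear_combination -hk₁
    · refine ⟨i + P - P', by omega, H' - H, Or.inr ?_⟩
      push_cast [h]
      linear_combination hk₂ - hk₁
  rcases Nat.even_or_odd k with hpar | hpar
  · rw [hpar.neg_one_pow] at step
    obtain ⟨i, hi, m, h₁, h₂⟩ := exists_mem_interval_of_steps (N := P') (by omega)
      (f := fun i => -(y + i * √2)) (e := ν) (δ := √2 * ν) hν (by
        intro i hi
        obtain ⟨j, hj, m, h⟩ := step i hi
        refine ⟨j, hj, -m, ?_⟩
        push_cast
        rcases h with h | h <;> constructor <;> nlinarith) (-(c + √2 * ν))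
    exact ⟨i, hi, -m, by push_cast; linarith, by push_cast; linarith⟩
  · rw [hpar.neg_one_pow] at step
    exact exists_mem_interval_of_steps (N := P') (by omega)
      (f := fun i => y + i * √2) (e := ν) (δ := √2 * ν) hν (by
        intro i hi
        obtain ⟨j, hj, m, h⟩ := step i hi
        refine ⟨j, hj, m, ?_⟩
        rcases h with h | h <;> constructor <;> nlinarith) c

lemma half_sqrt_two_add_ne_int (i : ℕ) (m : ℤ) : √2 / 2 + i * √2 ≠ m := by
  intro h
  have hirr : Irrational (((2 * i + 1 : ℕ) : ℝ) * √2) :=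
    irrational_sqrt_two.natCast_mul (by omega)
  refine hirr ⟨2 * m, ?_⟩
  push_cast
  linarith

/-- The letters at distance `p` cannot agree along `P (k + 1)` consecutive positions when
`p < H (k + 1)`. -/
lemma exists_bit_ne {k p : ℕ} (hp : 0 < p) (hpk : p < (pell (k + 1)).2) (s : ℕ) :
    ∃ i < (pell (k + 1)).1, bit (√2 / 2 + (s + i : ℕ) * √2) ≠
      bit (√2 / 2 + (s + i + p : ℕ) * √2) := by
  obtain ⟨q, hq⟩ : ∃ q : ℤ, |p * √2 - 2 * q| ≤ 1 := by
    refine ⟨round (p * √2 / 2), ?_⟩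
    have := abs_sub_round (p * √2 / 2)
    rw [abs_le] at this ⊢
    constructor <;> linarith
  have hδ := pell_best_approx hp hpk q
  set δ := √2 * (√2 - 1) ^ k
  rcases le_total 0 (p * √2 - 2 * q) with hβ | hβ
  · rw [abs_of_nonneg hβ] at hq hδ
    obtain ⟨i, hi, m, h₁, h₂⟩ := exists_rotation_mem_interval k (√2 / 2 + s * √2) (-δ)
    refine ⟨i, hi, ?_⟩
    have hne := half_sqrt_two_add_ne_int (s + i) (-m)
    have hlt : √2 / 2 + (s + i : ℕ) * √2 < (-m : ℤ) :=
      lt_of_le_of_ne (by push_cast; linarith) hne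
    push_cast at hlt
    have f₁ : ⌊√2 / 2 + (s + i : ℕ) * √2⌋ = -m - 1 := by
      rw [Int.floor_eq_iff]; push_cast; constructor <;> linarith
    have f₂ : ⌊√2 / 2 + (s + i + p : ℕ) * √2⌋ = -m + 2 * q := by
      rw [Int.floor_eq_iff]; push_cast; constructor <;> linarith
    rw [Ne, bit_eq_bit_iff, f₁, f₂]
    grind
  · rw [abs_of_nonpos hβ] at hq hδ
    obtain ⟨i, hi, m, h₁, h₂⟩ := exists_rotation_mem_interval k (√2 / 2 + s * √2) 0
    refine ⟨i, hi, ?_⟩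
    have hne := half_sqrt_two_add_ne_int (s + i + p) (-m + 2 * q)
    have hlt : √2 / 2 + (s + i + p : ℕ) * √2 < (-m + 2 * q : ℤ) :=
      lt_of_le_of_ne (by push_cast; linarith) hne
    push_cast at hlt
    have f₁ : ⌊√2 / 2 + (s + i : ℕ) * √2⌋ = -m := by
      rw [Int.floor_eq_iff]; push_cast; constructor <;> linarith
    have f₂ : ⌊√2 / 2 + (s + i + p : ℕ) * √2⌋ = -m + 2 * q - 1 := by
      rw [Int.floor_eq_iff]; push_cast; constructor <;> linarith
    rw [Ne, bit_eq_bit_iff, f₁, f₂]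
    grind

lemma pell_fst_succ_lt {k : ℕ} (hk : 0 < k) :
    ((pell (k + 1)).1 : ℝ) < (1 + √2 / 2) * (pell k).2 + 1 := by
  obtain ⟨hr, hr₁, hr₂⟩ := sqrt_two_bounds
  have h := pell_snd_sub k
  have habs : |(1 - √2) ^ k| < 1 := by
    rw [abs_pow]
    exact pow_lt_one₀ (abs_nonneg _) (by rw [abs_lt]; constructor <;> linarith) hk.ne'
  rw [← h, abs_lt] at habs
  simp only [pell]
  push_cast
  nlinarith

theorem stmt7 (n : ℕ) (w : List (Fin 2)) (p : ℕ)
    (hne : w ≠ []) (hfac : w <:+: applyM taum (phipow n [0])) (hper : IsPeriod w p) :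
    (w.length : ℝ) / p < 2 + Real.sqrt 2 / 2 := by
  obtain ⟨hp, -, hw⟩ := hper
  obtain ⟨s, t, hst⟩ := hfac
  obtain ⟨k, hk, hHp, hpH⟩ := exists_pell_le_lt hp
  have hp' : (0 : ℝ) < p := by exact_mod_cast hp
  rw [div_lt_iff₀ hp']
  by_contra! hlen
  have hlen' : (pell (k + 1)).1 + p ≤ w.length := by
    have h₁ := pell_fst_succ_lt hk
    have h₂ : ((pell k).2 : ℝ) ≤ p := by exact_mod_cast hHp
    have h₃ : (1 + √2 / 2) * (pell k).2 ≤ (1 + √2 / 2) * p := by gcongr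
    have h₄ : ((pell (k + 1)).1 + p : ℝ) < w.length + 1 := by linarith
    exact Nat.lt_succ_iff.1 (by exact_mod_cast h₄)
  have hget : ∀ i < w.length, w[i]? = some (bit (√2 / 2 + (s.length + i : ℕ) * √2)) := by
    intro i hi
    rw [← (isRotationCoding_phipow n).getElem? (by rw [← hst]; simp; omega), ← hst,
      List.append_assoc, List.getElem?_append_right (by omega),
      List.getElem?_append_left (by omega), Nat.add_sub_cancel_left]
  obtain ⟨i, hi, hne⟩ := exists_bit_ne hp hpH s.length
  have h := hw i (by omega)
  rw [hget i (by omega), hget (i + p) (by omega), ← add_assoc] at h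
  exact hne (Option.some.inj h)
end
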